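/- Let Ω ∈ K^{n×ℓ} be any random embedding that has full column rank almost surely. For any rank parameters q, r ∈ ℕ with q + α_K < ℓ ≤ r ≤ n, the supremum over all positive-semidefinite matrices H ∈ K^{n×n} with rank(H) = r of the ratio E tr(H − H⟨Ω⟩) / tr(H − [H]_q) is at least ((r − ℓ)/(r − q)) · (1 + q/(ℓ − q − α_K)). -/

import Mathlib

open MeasureTheory ProbabilityTheory Matrix Filter
open scoped ENNReal Topology ComplexOrder

noncomputable section

open Classical in
/-- `α_K`: 1 if `K = ℝ`, 0 if `K = ℂ`. -/
def alphaK (K : Type*) [RCLike K] : ℝ := if (RCLike.I : K) = 0 then 1 else 0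

/-- Squared Frobenius norm of a matrix. -/
def frobSq {K : Type*} [RCLike K] {m n : Type*} [Fintype m] [Fintype n]
    (A : Matrix m n K) : ℝ := ∑ i, ∑ j, ‖A i j‖ ^ 2

/-- The four Penrose conditions characterizing the Moore–Penrose pseudoinverse. -/
def IsMoorePenrose {K : Type*} [RCLike K] {m n : Type*} [Fintype m] [Fintype n]
    (A : Matrix m n K) (X : Matrix n m K) : Prop :=
  A * X * A = A ∧ X * A * X = X ∧ (A * X)ᴴ = A * X ∧ (X * A)ᴴ = X * A

instance matrixMeasurableSpace {m n α : Type*} [MeasurableSpace α] :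
    MeasurableSpace (Matrix m n α) :=
  inferInstanceAs (MeasurableSpace (m → n → α))

/-- `M` is rotation-invariant: `U * M` has the same distribution as `M` for every unitary `U`. -/
def RotationInvariant {K : Type*} [RCLike K] [MeasurableSpace K]
    {Y : Type*} [MeasurableSpace Y] (μ : Measure Y) {n ℓ : ℕ}
    (M : Y → Matrix (Fin n) (Fin ℓ) K) : Prop :=
  ∀ U : Matrix (Fin n) (Fin n) K, U ∈ Matrix.unitaryGroup (Fin n) K →
    Measure.map (fun ω => U * M ω) μ = Measure.map M μ

/-- `M` is a random orthonormal embedding: rotation-invariant, with orthonormal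
columns almost surely. -/
def IsRandomOrthonormal {K : Type*} [RCLike K] [MeasurableSpace K]
    {Y : Type*} [MeasurableSpace Y] (μ : Measure Y) {n ℓ : ℕ}
    (M : Y → Matrix (Fin n) (Fin ℓ) K) : Prop :=
  Measurable M ∧ RotationInvariant μ M ∧ ∀ᵐ ω ∂μ, (M ω)ᴴ * M ω = 1

/-- `Aq` is a best rank-`q` approximation of `A` in Frobenius norm
(equivalently, a matrix obtained from a `q`-truncated SVD of `A`). -/
def IsBestRankApprox {K : Type*} [RCLike K] {m n : Type*} [Fintype m] [Fintype n]
    [DecidableEq n] (q : ℕ) (A Aq : Matrix m n K) : Prop :=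
  Aq.rank ≤ q ∧ ∀ B : Matrix m n K, B.rank ≤ q → frobSq (A - Aq) ≤ frobSq (A - B)


/-! ### Gaussian-type integrals -/


lemma lintegral_Ioi_exp {a : ℝ} (ha : 0 < a) :
    ∫⁻ u in Set.Ioi (0:ℝ), ENNReal.ofReal (Real.exp (-(u * a))) = (ENNReal.ofReal a)⁻¹ := by
  rw [← ofReal_integral_eq_lintegral_ofReal]
  · have := integral_exp_mul_Ioi (a := -a) (by linarith) 0
    rw [← ENNReal.ofReal_inv_of_pos ha]
    congr 1
    rw [show (fun u : ℝ => Real.exp (-(u * a))) = fun u => Real.exp (-a * u) by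
      ext u; congr 1; ring, this]
    simp
  · have := integrableOn_exp_mul_Ioi (a := -a) (by linarith) 0
    rw [show (fun u : ℝ => Real.exp (-(u * a))) = fun u => Real.exp (-a * u) by
      ext u; congr 1; ring]
    exact this
  · exact Eventually.of_forall fun _ => (Real.exp_pos _).le

section gauss
variable {W : Type*} [NormedAddCommGroup W] [InnerProductSpace ℝ W] [FiniteDimensional ℝ W]
  [MeasurableSpace W] [BorelSpace W]

lemma lintegral_gauss {b : ℝ} (hb : 0 < b) :
    ∫⁻ v : W, ENNReal.ofReal (Real.exp (-(b * ‖v‖ ^ 2))) =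
      ENNReal.ofReal ((Real.pi / b) ^ (Module.finrank ℝ W / 2 : ℝ)) := by
  have h := GaussianFourier.integral_rexp_neg_mul_sq_norm (V := W) hb
  have hpos : 0 < (Real.pi / b) ^ (Module.finrank ℝ W / 2 : ℝ) :=
    Real.rpow_pos_of_pos (by positivity) _
  rw [← h, ofReal_integral_eq_lintegral_ofReal]
  · simp
  · by_contra hc
    rw [integral_undef hc] at h
    linarith
  · exact Eventually.of_forall fun _ => (Real.exp_pos _).le

lemma lintegral_gauss_inv (hD : 2 < Module.finrank ℝ W) :
    ∫⁻ v : W, ENNReal.ofReal (Real.exp (-‖v‖ ^ 2)) * (ENNReal.ofReal (‖v‖ ^ 2))⁻¹ =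
      ENNReal.ofReal (Real.pi ^ (Module.finrank ℝ W / 2 : ℝ) *
        (2 / ((Module.finrank ℝ W : ℝ) - 2))) := by
  set D := Module.finrank ℝ W with hDdef
  have hD' : (2:ℝ) < D := by exact_mod_cast hD
  have : Nontrivial W := Module.nontrivial_of_finrank_pos (R := ℝ) (by omega)
  have h1 : ∀ᵐ v : W, ENNReal.ofReal (Real.exp (-‖v‖ ^ 2)) * (ENNReal.ofReal (‖v‖ ^ 2))⁻¹ =
      ∫⁻ u in Set.Ioi (0:ℝ), ENNReal.ofReal (Real.exp (-((1 + u) * ‖v‖ ^ 2))) := by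
    have : ∀ᵐ v : W, v ≠ 0 := by
      simp [ae_iff]
    filter_upwards [this] with v hv
    rw [← lintegral_Ioi_exp (by positivity : 0 < ‖v‖ ^ 2), ← lintegral_const_mul _ (by fun_prop)]
    congr 1; ext u
    rw [← ENNReal.ofReal_mul (Real.exp_pos _).le, ← Real.exp_add]
    congr 2; ring
  rw [lintegral_congr_ae h1, lintegral_lintegral_swap (by fun_prop)]
  have h2 : ∀ u ∈ Set.Ioi (0:ℝ), (∫⁻ v : W, ENNReal.ofReal (Real.exp (-((1 + u) * ‖v‖ ^ 2)))) =
      ENNReal.ofReal (Real.pi ^ (D / 2 : ℝ) * (u + 1) ^ (-(D / 2 : ℝ))) := by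
    intro u hu
    have hu' : 0 < 1 + u := by have : 0 < u := hu; linarith
    rw [lintegral_gauss hu', Real.div_rpow Real.pi_pos.le hu'.le, div_eq_mul_inv,
      Real.rpow_neg (by linarith), add_comm u 1]
  rw [setLIntegral_congr_fun measurableSet_Ioi h2]
  have hIntOn : IntegrableOn (fun u : ℝ => (u + 1) ^ (-(D / 2 : ℝ))) (Set.Ioi 0) :=
    integrableOn_add_rpow_Ioi_of_lt (by linarith) (by norm_num)
  rw [← ofReal_integral_eq_lintegral_ofReal (hIntOn.const_mul _)]
  · congr 1
    rw [integral_const_mul]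
    congr 1
    have h3 : ∫ u in Set.Ioi (0:ℝ), (u + 1) ^ (-(D / 2 : ℝ)) =
        ∫ u in Set.Ioi (1:ℝ), u ^ (-(D / 2 : ℝ)) := by
      have := (measurePreserving_add_right volume (1:ℝ)).setIntegral_preimage_emb
        (measurableEmbedding_addRight 1) (fun u : ℝ => u ^ (-(D / 2 : ℝ))) (Set.Ioi 1)
      rw [← this]
      congr 2
      ext u; simp
    rw [h3, integral_Ioi_rpow_of_lt (by linarith) (by norm_num)]
    simp
    field_simp
    have : (D:ℝ) - 2 ≠ 0 := by linarith
    have : -(D:ℝ) + 2 ≠ 0 := by linarith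
    field_simp
    ring
  · refine (ae_restrict_mem measurableSet_Ioi).mono fun u hu => ?_
    have : 0 < u := hu
    simp only [Pi.zero_apply]
    positivity

lemma lintegral_gauss_proj (S : Submodule ℝ W) (hD : 2 < Module.finrank ℝ S) :
    ∫⁻ v : W, ENNReal.ofReal (Real.exp (-‖v‖ ^ 2)) *
        (ENNReal.ofReal (‖S.orthogonalProjectionOnto v‖ ^ 2))⁻¹ =
      ENNReal.ofReal (Real.pi ^ (Module.finrank ℝ W / 2 : ℝ) *
        (2 / ((Module.finrank ℝ S : ℝ) - 2))) := by
  let f : WithLp 2 (S × Sᗮ) → ℝ≥0∞ := fun z => ENNReal.ofReal (Real.exp (-‖z.ofLp.1‖ ^ 2)) *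
     (ENNReal.ofReal (‖z.ofLp.1‖ ^ 2))⁻¹ * ENNReal.ofReal (Real.exp (-‖z.ofLp.2‖ ^ 2))
  have hf : ∀ v : W, ENNReal.ofReal (Real.exp (-‖v‖ ^ 2)) *
        (ENNReal.ofReal (‖S.orthogonalProjectionOnto v‖ ^ 2))⁻¹ = f (S.orthogonalDecomposition v) := by
    intro v
    have h1 : ‖v‖ ^ 2 = ‖S.orthogonalProjectionOnto v‖ ^ 2 + ‖Sᗮ.orthogonalProjectionOnto v‖ ^ 2 :=
      S.norm_sq_eq_add_norm_sq_projection v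
    simp only [f, Submodule.orthogonalDecomposition_apply]
    rw [h1, neg_add, Real.exp_add, ENNReal.ofReal_mul (Real.exp_pos _).le]
    ring
  simp_rw [hf]
  have hm1 : Measurable (fun a : S => ENNReal.ofReal (Real.exp (-‖a‖ ^ 2)) *
     (ENNReal.ofReal (‖a‖ ^ 2))⁻¹) := by fun_prop
  have hm2 : Measurable (fun a : Sᗮ => ENNReal.ofReal (Real.exp (-‖a‖ ^ 2))) := by fun_prop
  let g : S × Sᗮ → ℝ≥0∞ := fun z => (ENNReal.ofReal (Real.exp (-‖z.1‖ ^ 2)) *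
     (ENNReal.ofReal (‖z.1‖ ^ 2))⁻¹) * ENNReal.ofReal (Real.exp (-‖z.2‖ ^ 2))
  have hg : Measurable g := (hm1.comp measurable_fst).mul (hm2.comp measurable_snd)
  have e1 := (LinearIsometryEquiv.measurePreserving S.orthogonalDecomposition)
  have e2 := (WithLp.volume_preserving_ofLp S Sᗮ)
  have e3 := (e2.comp e1).lintegral_comp hg
  have : ∀ v, f (S.orthogonalDecomposition v) = g ((WithLp.ofLp ∘ S.orthogonalDecomposition) v) :=
    fun v => rfl
  simp_rw [this]
  rw [e3]
  change ∫⁻ z : S × Sᗮ, g z ∂(volume.prod volume) = _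
  rw [lintegral_prod_mul hm1.aemeasurable hm2.aemeasurable, lintegral_gauss_inv hD]
  have h4 := lintegral_gauss (W := Sᗮ) one_pos
  simp only [one_mul, div_one] at h4
  rw [h4, ← ENNReal.ofReal_mul]
  · congr 1
    have h5 := S.finrank_add_finrank_orthogonal
    have h6 : (Module.finrank ℝ W : ℝ) = Module.finrank ℝ S + Module.finrank ℝ Sᗮ := by
      exact_mod_cast h5.symm
    rw [h6, add_div, Real.rpow_add Real.pi_pos]
    ring
  · have : (2:ℝ) < Module.finrank ℝ S := by exact_mod_cast hD
    have : 0 < (Module.finrank ℝ S : ℝ) - 2 := by linarith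
    positivity

end gauss

set_option linter.style.haveILetI false

/-! ### Parametrizing subspaces by real Euclidean spaces -/

lemma finrank_real_K (K : Type*) [RCLike K] : (Module.finrank ℝ K : ℝ) = 2 - alphaK K := by
  by_cases h : (RCLike.I : K) = 0
  · have e := (RCLike.realLinearIsometryEquiv h).toLinearEquiv.finrank_eq
    rw [e]; simp [alphaK, h]; norm_num
  · have h1 : RCLike.im (RCLike.I : K) = 1 := by
      rcases RCLike.I_eq_zero_or_im_I_eq_one (K := K) with h' | h'
      · exact absurd h' h
      · exact h'
    have e := (RCLike.complexLinearIsometryEquiv h1).toLinearEquiv.finrank_eq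
    rw [e]; simp [alphaK, h]

section param
variable {K : Type*} [RCLike K] {X : Type*} [NormedAddCommGroup X] [InnerProductSpace K X]
  [FiniteDimensional K X]

/-- `J` is a real-linear isometric parametrization of the `K`-subspace `E`. -/
structure IsParam (E : Submodule K X) {N : ℕ} (J : EuclideanSpace ℝ (Fin N) → X) : Prop where
  add : ∀ x y, J (x + y) = J x + J y
  smul : ∀ (c : ℝ) x, J (c • x) = (c : K) • J x
  inner : ∀ x y, RCLike.re (inner K (J x) (J y)) = inner ℝ x y
  norm : ∀ x, ‖J x‖ = ‖x‖
  mem : ∀ x, J x ∈ E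
  surj : ∀ e ∈ E, ∃ x, J x = e

lemma exists_param (E : Submodule K X) :
    ∃ J : EuclideanSpace ℝ (Fin (Module.finrank ℝ K * Module.finrank K E)) → X, IsParam E J := by
  letI : InnerProductSpace ℝ E := InnerProductSpace.rclikeToReal K E
  haveI : IsScalarTower ℝ K E := ⟨fun c k x => by
    change (c • k) • x = (c : K) • (k • x)
    rw [RCLike.real_smul_eq_coe_mul, mul_smul]⟩
  haveI : FiniteDimensional ℝ E := FiniteDimensional.trans ℝ K E
  have hfr : Module.finrank ℝ E = Module.finrank ℝ K * Module.finrank K E :=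
    (Module.finrank_mul_finrank ℝ K E).symm
  let b := (stdOrthonormalBasis ℝ E).reindex (finCongr hfr)
  refine ⟨fun x => (b.repr.symm x : X), ?_, ?_, ?_, ?_, ?_, ?_⟩
  · intro x y; simp
  · intro c x
    rw [map_smul]; rfl
  · intro x y
    rw [← b.repr.symm.inner_map_map x y]
    rfl
  · intro x
    exact b.repr.symm.norm_map x
  · intro x; exact Subtype.property _
  · intro e he
    exact ⟨b.repr ⟨e, he⟩, by simp⟩

/-- preimage of a `K`-subspace under a parametrization. -/
def paramPre {E : Submodule K X} {N : ℕ} {J : EuclideanSpace ℝ (Fin N) → X} (hJ : IsParam E J)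
    (C : Submodule K X) : Submodule ℝ (EuclideanSpace ℝ (Fin N)) where
  carrier := {x | J x ∈ C}
  add_mem' := by
    intro a b ha hb
    simp only [Set.mem_ofPred_eq, hJ.add] at *
    exact C.add_mem ha hb
  zero_mem' := by
    have : J 0 = 0 := by rw [← norm_eq_zero, hJ.norm]; simp
    simp [this]
  smul_mem' := by
    intro c x hx
    simp only [Set.mem_ofPred_eq, hJ.smul] at *
    exact C.smul_mem _ hx

lemma finrank_paramPre {E : Submodule K X} {N : ℕ} {J : EuclideanSpace ℝ (Fin N) → X}
    (hJ : IsParam E J) (C : Submodule K X) :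
    Module.finrank ℝ (paramPre hJ C) =
      Module.finrank ℝ K * Module.finrank K (C ⊓ E : Submodule K X) := by
  letI : InnerProductSpace ℝ X := InnerProductSpace.rclikeToReal K X
  letI : Module ℝ (C ⊓ E : Submodule K X) :=
    (InnerProductSpace.rclikeToReal K (C ⊓ E : Submodule K X)).toModule
  haveI : IsScalarTower ℝ K (C ⊓ E : Submodule K X) := ⟨fun c k x => by
    change (c • k) • x = (c : K) • (k • x)
    rw [RCLike.real_smul_eq_coe_mul, mul_smul]⟩
  rw [Module.finrank_mul_finrank ℝ K (C ⊓ E : Submodule K X)]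
  let f : paramPre hJ C →ₗ[ℝ] (C ⊓ E : Submodule K X) :=
    { toFun := fun x => ⟨J x, x.2, hJ.mem _⟩
      map_add' := fun x y => by ext; exact hJ.add _ _
      map_smul' := fun c x => by ext; exact hJ.smul _ _ }
  have hf : Function.Bijective f := by
    constructor
    · rw [← LinearMap.ker_eq_bot, LinearMap.ker_eq_bot']
      intro x hx
      have h1 : J x = 0 := congrArg Subtype.val hx
      have h2 : ‖(x : EuclideanSpace ℝ (Fin N))‖ = 0 := by rw [← hJ.norm, h1, norm_zero]
      ext1
      exact norm_eq_zero.mp h2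
    · rintro ⟨c, hc⟩
      obtain ⟨x, hx⟩ := hJ.surj c hc.2
      refine ⟨⟨x, ?_⟩, ?_⟩
      · change J x ∈ C
        rw [hx]; exact hc.1
      · ext; exact hx
  exact (LinearEquiv.ofBijective f hf).finrank_eq

lemma iSup_param (L B : Submodule K X) {N : ℕ} {J : EuclideanSpace ℝ (Fin N) → X}
    (hJ : IsParam Lᗮ J) (x : EuclideanSpace ℝ (Fin N)) :
    ⨆ w : L, (ENNReal.ofReal (‖B.starProjection (J x - w)‖ ^ 2))⁻¹ =
      (ENNReal.ofReal (‖(paramPre hJ B).orthogonalProjectionOnto x‖ ^ 2))⁻¹ := by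
  set S := paramPre hJ B with hS
  apply le_antisymm
  · refine iSup_le fun w => ?_
    rw [ENNReal.inv_le_inv]
    apply ENNReal.ofReal_le_ofReal
    gcongr
    set s := S.orthogonalProjectionOnto x with hs
    have hsB : J s ∈ B := s.2
    have hsL : J s ∈ Lᗮ := hJ.mem _
    have h1 : ‖s‖ ^ 2 = inner ℝ (s : EuclideanSpace ℝ (Fin N)) x := by
      rw [← real_inner_self_eq_norm_sq, Submodule.coe_inner]
      have : inner ℝ (s : EuclideanSpace ℝ (Fin N)) (x - s) = 0 := by
        have := S.sub_starProjection_mem_orthogonal x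
        exact this s s.2
      rw [inner_sub_right] at this
      linarith
    have h2 : inner K (J s) (J x) = inner K (J s) (B.starProjection (J x - w)) := by
      rw [← Submodule.inner_starProjection_left_eq_right, (B.starProjection_eq_self_iff).2 hsB,
        inner_sub_right, (L.mem_orthogonal' _).1 hsL w w.2, sub_zero]
    have h3 : ‖s‖ ^ 2 ≤ ‖s‖ * ‖B.starProjection (J x - w)‖ := by
      rw [h1, ← hJ.inner, h2]
      calc _ ≤ ‖J s‖ * ‖B.starProjection (J x - w)‖ := re_inner_le_norm _ _
        _ = _ := by rw [hJ.norm]; rfl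
    by_cases h0 : ‖s‖ = 0
    · rw [h0]; positivity
    · have : 0 < ‖s‖ := lt_of_le_of_ne (norm_nonneg _) (Ne.symm h0)
      nlinarith
  · set M := L.map (B.starProjection : X →ₗ[K] X) with hM
    have hmem : M.starProjection (B.starProjection (J x)) ∈ M := M.starProjection_apply_mem _
    obtain ⟨w, hwL, hw⟩ := hmem
    have hw' : M.starProjection (B.starProjection (J x)) = B.starProjection w := hw.symm
    set b := B.starProjection (J x - w) with hb
    have hbB : b ∈ B := B.starProjection_apply_mem _
    have hbM : b ∈ Mᗮ := by
      have := M.sub_starProjection_mem_orthogonal (B.starProjection (J x))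
      rwa [hw', ← map_sub] at this
    have hbL : b ∈ Lᗮ := by
      rw [Submodule.mem_orthogonal']
      intro l hl
      rw [← (B.starProjection_eq_self_iff).2 hbB, Submodule.inner_starProjection_left_eq_right]
      exact (M.mem_orthogonal' _).1 hbM _ ⟨l, hl, rfl⟩
    obtain ⟨s', hs'⟩ := hJ.surj b hbL
    have hs'S : s' ∈ S := by
      change J s' ∈ B
      rw [hs']; exact hbB
    have hproj : S.starProjection x = s' := by
      apply Submodule.eq_starProjection_of_mem_orthogonal hs'S
      rw [Submodule.mem_orthogonal]
      intro s hs
      have hsB : J s ∈ B := hs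
      rw [inner_sub_right, ← hJ.inner, ← hJ.inner, hs', hb,
        ← Submodule.inner_starProjection_left_eq_right, (B.starProjection_eq_self_iff).2 hsB,
        inner_sub_right, (L.mem_orthogonal' _).1 (hJ.mem s) w hwL, sub_zero, sub_self]
    refine le_trans (le_of_eq ?_) (le_iSup _ (⟨w, hwL⟩ : L))
    congr 2
    change ‖S.starProjection x‖ ^ 2 = ‖b‖ ^ 2
    rw [hproj, ← hJ.norm s', hs']

end param

/-! ### The unitary group with its Haar measure -/

section haar
variable {K : Type*} [RCLike K] {r : ℕ}

/-- the unitary group. -/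
abbrev UG (K : Type*) [RCLike K] (r : ℕ) := Matrix.unitaryGroup (Fin r) K

instance instCompactUG : CompactSpace (UG K r) := by
  have h1 : IsClosed ((UG K r : Submonoid (Matrix (Fin r) (Fin r) K)) :
      Set (Matrix (Fin r) (Fin r) K)) := by
    have : ((UG K r : Submonoid (Matrix (Fin r) (Fin r) K)) :
      Set (Matrix (Fin r) (Fin r) K)) = {A | star A * A = 1} ∩ {A | A * star A = 1} := by
      ext A
      exact Unitary.mem_iff
    rw [this]
    exact (isClosed_eq (by fun_prop) continuous_const).inter
      (isClosed_eq (by fun_prop) continuous_const)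
  have h2 : IsCompact (Set.univ.pi fun _ => Set.univ.pi fun _ => Metric.closedBall 0 1 :
      Set (Fin r → Fin r → K)) :=
    isCompact_univ_pi fun _ => isCompact_univ_pi fun _ => isCompact_closedBall 0 1
  refine isCompact_iff_compactSpace.mp (h2.of_isClosed_subset (s := (Set.univ.pi fun _ =>
    Set.univ.pi fun _ => Metric.closedBall 0 1 : Set (Matrix (Fin r) (Fin r) K))) h1 ?_)
  intro U hU i _ j _
  simpa using entry_norm_bound_of_unitary hU i j

instance instSCMat {m n : Type*} [Fintype m] [Fintype n] :
    SecondCountableTopology (Matrix m n K) :=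
  inferInstanceAs (SecondCountableTopology (m → n → K))

instance instBorelMat {m n : Type*} [Fintype m] [Fintype n] [MeasurableSpace K] [BorelSpace K] :
    BorelSpace (Matrix m n K) :=
  inferInstanceAs (BorelSpace (m → n → K))

instance instSCUG : SecondCountableTopology (UG K r) :=
  TopologicalSpace.Subtype.secondCountableTopology _

/-- The unitary group acting by linear isometries. -/
def iso (V : UG K r) : EuclideanSpace K (Fin r) ≃ₗᵢ[K] EuclideanSpace K (Fin r) :=
  Unitary.linearIsometryEquiv ⟨Matrix.toEuclideanCLM (n := Fin r) (𝕜 := K) V.1,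
    Unitary.map_mem (Matrix.toEuclideanCLM (n := Fin r) (𝕜 := K)) V.2⟩

lemma iso_apply (V : UG K r) (x : EuclideanSpace K (Fin r)) :
    iso V x = WithLp.toLp 2 (V.1 *ᵥ x.ofLp) := rfl

lemma iso_symm_apply (V : UG K r) (x : EuclideanSpace K (Fin r)) :
    (iso V).symm x = WithLp.toLp 2 (V.1ᴴ *ᵥ x.ofLp) := by
  rw [LinearIsometryEquiv.symm_apply_eq, iso_apply]
  have : V.1 * V.1ᴴ = 1 := (Unitary.mem_iff.1 V.2).2
  simp [this]

lemma iso_mul_symm_apply (W V : UG K r) (x : EuclideanSpace K (Fin r)) :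
    (iso (W * V)).symm x = (iso V).symm ((iso W).symm x) := by
  simp [iso_symm_apply, Matrix.conjTranspose_mul]

lemma exists_iso (T : EuclideanSpace K (Fin r) ≃ₗᵢ[K] EuclideanSpace K (Fin r)) :
    ∃ W : UG K r, ∀ x, (iso W).symm x = T x := by
  let W0 : unitary (EuclideanSpace K (Fin r) →L[K] EuclideanSpace K (Fin r)) :=
    Unitary.linearIsometryEquiv.symm T.symm
  let W : UG K r := ⟨(Matrix.toEuclideanCLM (n := Fin r) (𝕜 := K)).symm W0.1,
    Unitary.map_mem (Matrix.toEuclideanCLM (n := Fin r) (𝕜 := K)).symm W0.2⟩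
  refine ⟨W, fun x => ?_⟩
  have h : iso W = T.symm := by
    have h2 : Matrix.toEuclideanCLM (n := Fin r) (𝕜 := K) W.1 = W0.1 :=
      (Matrix.toEuclideanCLM (n := Fin r) (𝕜 := K)).apply_symm_apply W0.1
    have h3 : iso W = Unitary.linearIsometryEquiv W0 := by
      unfold iso
      congr 1
      exact Subtype.ext h2
    rw [h3]
    simp [W0]
  rw [h]; simp

lemma exists_transitive {X : Type*} [NormedAddCommGroup X] [InnerProductSpace K X]
    [FiniteDimensional K X] (L : Submodule K X) (n n' : X) (hn : n ∈ Lᗮ) (hn' : n' ∈ Lᗮ)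
    (h1 : ‖n‖ = 1) (h1' : ‖n'‖ = 1) :
    ∃ T : X ≃ₗᵢ[K] X, (∀ w ∈ L, T w = w) ∧ T n = n' := by
  classical
  have hpos : 0 < Module.finrank K Lᗮ := by
    have : Nontrivial Lᗮ := ⟨⟨n, hn⟩, 0, fun h => by
      have : n = 0 := congrArg Subtype.val h
      rw [this] at h1; simp at h1⟩
    exact Module.finrank_pos
  let i0 : Fin (Module.finrank K Lᗮ) := ⟨0, hpos⟩
  have key : ∀ m : Lᗮ, ‖m‖ = 1 → ∃ b : OrthonormalBasis (Fin (Module.finrank K Lᗮ)) K Lᗮ,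
      b i0 = m := by
    intro m hm
    obtain ⟨b, hb⟩ := Orthonormal.exists_orthonormalBasis_extension_of_card_eq (𝕜 := K)
      (ι := Fin (Module.finrank K Lᗮ)) (by simp) (v := fun _ => m) (s := {i0})
      (by
        constructor
        · intro i; simpa using hm
        · intro i j hij; exact absurd (Subsingleton.elim i j) hij)
    exact ⟨b, hb i0 rfl⟩
  obtain ⟨b, hb⟩ := key ⟨n, hn⟩ h1
  obtain ⟨b', hb'⟩ := key ⟨n', hn'⟩ h1'
  let w : Lᗮ ≃ₗᵢ[K] Lᗮ := b.equiv b' (Equiv.refl _)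
  have hw : w ⟨n, hn⟩ = ⟨n', hn'⟩ := by
    rw [← hb, ← hb']; simp [w]
  let f : X →ₗ[K] X := (L.starProjection : X →ₗ[K] X) +
    Lᗮ.subtype ∘ₗ (w.toLinearEquiv : Lᗮ →ₗ[K] Lᗮ) ∘ₗ (Lᗮ.orthogonalProjectionOnto : X →ₗ[K] Lᗮ)
  have hf : ∀ x, f x = L.starProjection x + (w (Lᗮ.orthogonalProjectionOnto x) : X) :=
    fun x => rfl
  have hnorm : ∀ x, ‖f x‖ = ‖x‖ := by
    intro x
    have e1 : ‖f x‖ * ‖f x‖ = ‖L.starProjection x‖ * ‖L.starProjection x‖ +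
        ‖(w (Lᗮ.orthogonalProjectionOnto x) : X)‖ * ‖(w (Lᗮ.orthogonalProjectionOnto x) : X)‖ := by
      rw [hf]
      refine norm_add_sq_eq_norm_sq_add_norm_sq_of_inner_eq_zero (𝕜 := K) _ _ ?_
      exact (L.mem_orthogonal _).1 (w (Lᗮ.orthogonalProjectionOnto x)).2 _
        (L.starProjection_apply_mem x)
    have e2 := L.norm_sq_eq_add_norm_sq_projection x
    have e3 : ‖(w (Lᗮ.orthogonalProjectionOnto x) : X)‖ = ‖Lᗮ.orthogonalProjectionOnto x‖ :=
      w.norm_map _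
    have e4 : ‖L.starProjection x‖ = ‖L.orthogonalProjectionOnto x‖ := rfl
    rw [e3, e4] at e1
    have : ‖f x‖ ^ 2 = ‖x‖ ^ 2 := by rw [e2]; linarith
    exact (sq_eq_sq₀ (norm_nonneg _) (norm_nonneg _)).1 this
  let T0 : X →ₗᵢ[K] X := ⟨f, hnorm⟩
  refine ⟨T0.toLinearIsometryEquiv rfl, ?_, ?_⟩
  · intro x hx
    change f x = x
    rw [hf, (L.starProjection_eq_self_iff).2 hx]
    have : Lᗮ.orthogonalProjectionOnto x = 0 := by
      rw [Submodule.orthogonalProjectionOnto_eq_zero_iff]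
      exact L.le_orthogonal_orthogonal hx
    rw [this]; simp
  · change f n = n'
    rw [hf]
    have e1 : L.starProjection n = 0 := by
      rw [Submodule.starProjection_apply_eq_zero_iff]; exact hn
    have e2 : Lᗮ.orthogonalProjectionOnto n = ⟨n, hn⟩ := by
      ext1
      exact (Lᗮ.starProjection_eq_self_iff).2 hn
    rw [e1, e2, hw]; simp

/-- weighted sum of squares -/
def wt (c : Fin r → ℝ) (y : EuclideanSpace K (Fin r)) : ℝ := ∑ i, c i * ‖y i‖ ^ 2

/-- The main functional. -/
def FF (c : Fin r → ℝ) (L : Submodule K (EuclideanSpace K (Fin r))) (V : UG K r)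
    (g : EuclideanSpace K (Fin r)) : ℝ≥0∞ :=
  ⨆ w : L, (ENNReal.ofReal (wt c ((iso V).symm (g - w))))⁻¹

lemma FF_lsc (c : Fin r → ℝ) (L : Submodule K (EuclideanSpace K (Fin r))) :
    LowerSemicontinuous fun p : UG K r × EuclideanSpace K (Fin r) => FF c L p.1 p.2 := by
  refine lowerSemicontinuous_iSup fun w => Continuous.lowerSemicontinuous ?_
  refine continuous_inv.comp (ENNReal.continuous_ofReal.comp ?_)
  unfold wt
  simp_rw [iso_symm_apply]
  have h : Continuous fun p : UG K r × EuclideanSpace K (Fin r) =>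
      (p.1.1ᴴ *ᵥ (p.2 - (w : EuclideanSpace K (Fin r))).ofLp) :=
    Continuous.matrix_mulVec (by fun_prop) (by fun_prop)
  refine continuous_finsetSum _ fun i _ => continuous_const.mul ?_
  exact ((continuous_apply i).comp h).norm.pow 2

lemma FF_mul (c : Fin r → ℝ) (L : Submodule K (EuclideanSpace K (Fin r))) (W V : UG K r)
    (hW : ∀ w ∈ L, (iso W).symm w = w) (g : EuclideanSpace K (Fin r)) :
    FF c L (W * V) g = FF c L V ((iso W).symm g) := by
  unfold FF
  congr 1; ext w
  rw [iso_mul_symm_apply, map_sub, hW w w.2]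

lemma FF_smul (c : Fin r → ℝ) (L : Submodule K (EuclideanSpace K (Fin r))) (V : UG K r)
    (g : EuclideanSpace K (Fin r)) {a : ℝ} (ha : 0 < a) :
    FF c L V ((a : K) • g) = (ENNReal.ofReal (a ^ 2))⁻¹ * FF c L V g := by
  have ha' : (a : K) ≠ 0 := by exact_mod_cast ha.ne'
  unfold FF
  rw [ENNReal.mul_iSup]
  have key : ∀ y : EuclideanSpace K (Fin r), (ENNReal.ofReal (wt c ((a : K) • y)))⁻¹ =
      (ENNReal.ofReal (a ^ 2))⁻¹ * (ENNReal.ofReal (wt c y))⁻¹ := by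
    intro y
    rw [← ENNReal.mul_inv, ← ENNReal.ofReal_mul (by positivity)]
    · congr 2
      unfold wt
      rw [Finset.mul_sum]
      refine Finset.sum_congr rfl fun i _ => ?_
      simp [norm_smul, mul_pow]; ring
    · left
      simp; positivity
    · left; simp
  let e : L ≃ L :=
    { toFun := fun w => (a : K) • w
      invFun := fun w => (a : K)⁻¹ • w
      left_inv := fun w => inv_smul_smul₀ ha' w
      right_inv := fun w => smul_inv_smul₀ ha' w }
  rw [← e.iSup_comp]
  congr 1; ext w
  rw [← key, ← map_smul, smul_sub]
  rfl

variable [MeasurableSpace K] [BorelSpace K]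

/-- The Haar probability measure. -/
def hU (K : Type*) [RCLike K] [MeasurableSpace K] [BorelSpace K] (r : ℕ) : Measure (UG K r) :=
  Measure.haarMeasure (⊤ : TopologicalSpace.PositiveCompacts (UG K r))

instance instProbHU : IsProbabilityMeasure (hU K r) :=
  ⟨by simpa [hU] using Measure.haarMeasure_self (K₀ := (⊤ : TopologicalSpace.PositiveCompacts (UG K r)))⟩

instance instLeftHU : (hU K r).IsMulLeftInvariant := by unfold hU; infer_instance

lemma FF_measurable (c : Fin r → ℝ) (L : Submodule K (EuclideanSpace K (Fin r))) {Z : Type*}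
    [TopologicalSpace Z] [MeasurableSpace Z] [OpensMeasurableSpace Z] [SecondCountableTopology Z]
    (J : Z → EuclideanSpace K (Fin r)) (hJ : Continuous J) :
    Measurable fun p : UG K r × Z => FF c L p.1 (J p.2) := by
  have h : LowerSemicontinuous fun p : UG K r × Z => FF c L p.1 (J p.2) :=
    (FF_lsc c L).comp (g := fun p : UG K r × Z => (p.1, J p.2)) (by fun_prop)
  exact h.measurable

lemma FF_measurable_left (c : Fin r → ℝ) (L : Submodule K (EuclideanSpace K (Fin r)))
    (g : EuclideanSpace K (Fin r)) : Measurable fun V : UG K r => FF c L V g := by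
  have h : LowerSemicontinuous fun V : UG K r => FF c L V g :=
    (FF_lsc c L).comp (g := fun V : UG K r => (V, g)) (by fun_prop)
  exact h.measurable

lemma FF_const (c : Fin r → ℝ) (L : Submodule K (EuclideanSpace K (Fin r)))
    (n g : EuclideanSpace K (Fin r)) (hn : n ∈ Lᗮ) (hg : g ∈ Lᗮ) (hn1 : ‖n‖ = 1) (hg0 : g ≠ 0) :
    ∫⁻ V, FF c L V g ∂(hU K r) = (ENNReal.ofReal (‖g‖ ^ 2))⁻¹ * ∫⁻ V, FF c L V n ∂(hU K r) := by
  have hpos : 0 < ‖g‖ := norm_pos_iff.2 hg0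
  have hne : ((‖g‖ : ℝ) : K) ≠ 0 := by exact_mod_cast hpos.ne'
  set n' := ((‖g‖ : ℝ) : K)⁻¹ • g with hn'
  have hgn : g = ((‖g‖ : ℝ) : K) • n' := by rw [hn', smul_smul, mul_inv_cancel₀ hne, one_smul]
  have hn'1 : ‖n'‖ = 1 := by
    rw [hn', norm_smul, norm_inv, RCLike.norm_ofReal, abs_of_pos hpos, inv_mul_cancel₀ hpos.ne']
  have hn'L : n' ∈ Lᗮ := Lᗮ.smul_mem _ hg
  obtain ⟨T, hT1, hT2⟩ := exists_transitive L n n' hn hn'L hn1 hn'1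
  obtain ⟨W, hW⟩ := exists_iso T
  have e1 : ∀ V, FF c L V g = (ENNReal.ofReal (‖g‖ ^ 2))⁻¹ * FF c L (W * V) n := by
    intro V
    rw [FF_mul c L W V (fun w hw => by rw [hW, hT1 w hw]), hW, hT2, ← FF_smul c L V n' hpos, ← hgn]
  have hm : Measurable fun V => FF c L (W * V) n :=
    (FF_measurable_left c L n).comp (measurable_const_mul W)
  simp_rw [e1]
  rw [lintegral_const_mul _ hm,
    lintegral_mul_left_eq_self (fun V => FF c L V n) W]

end haar

/-! ### The value of the averaged functional -/

section value
variable {K : Type*} [RCLike K] {r q : ℕ}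

/-- indicator weights of the last coordinates -/
def ind (q : ℕ) (i : Fin r) : ℝ := if (i : ℕ) < q then 0 else 1

/-- first coordinates -/
def prq (K : Type*) [RCLike K] (hqr : q ≤ r) : EuclideanSpace K (Fin r) →ₗ[K] (Fin q → K) :=
  LinearMap.funLeft K K (Fin.castLE hqr) ∘ₗ (WithLp.linearEquiv 2 K (Fin r → K)).toLinearMap

/-- subspace of vectors with vanishing first coordinates -/
def Bq (K : Type*) [RCLike K] (hqr : q ≤ r) : Submodule K (EuclideanSpace K (Fin r)) :=
  LinearMap.ker (prq K hqr)

lemma mem_Bq (hqr : q ≤ r) (y : EuclideanSpace K (Fin r)) :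
    y ∈ Bq K hqr ↔ ∀ i : Fin r, (i : ℕ) < q → y i = 0 := by
  rw [Bq, LinearMap.mem_ker]
  constructor
  · intro h i hi
    exact congrFun h ⟨i, hi⟩
  · intro h
    funext i
    exact h (Fin.castLE hqr i) i.2

lemma finrank_Bq (hqr : q ≤ r) : Module.finrank K (Bq K hqr) = r - q := by
  have h := LinearMap.finrank_range_add_finrank_ker (prq K hqr)
  have hs : Function.Surjective (prq K hqr) := by
    unfold prq
    rw [LinearMap.coe_comp]
    exact (LinearMap.funLeft_surjective_of_injective K K _ (Fin.castLE_injective hqr)).comp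
      (WithLp.linearEquiv 2 K (Fin r → K)).surjective
  rw [LinearMap.range_eq_top.2 hs, finrank_top] at h
  simp at h
  unfold Bq
  omega

lemma wt_ind (hqr : q ≤ r) (y : EuclideanSpace K (Fin r)) :
    wt (ind q) y = ‖(Bq K hqr).starProjection y‖ ^ 2 := by
  have h : (Bq K hqr).starProjection y = WithLp.toLp 2 (fun i => ((ind q i : ℝ) : K) * y i) := by
    apply Submodule.eq_starProjection_of_mem_of_inner_eq_zero
    · rw [mem_Bq]
      intro i hi
      simp [ind, hi]
    · intro w hw
      rw [mem_Bq] at hw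
      rw [PiLp.inner_apply]
      refine Finset.sum_eq_zero fun i _ => ?_
      by_cases hi : (i : ℕ) < q
      · simp [hw i hi]
      · simp [ind, hi]
  rw [h, EuclideanSpace.norm_sq_eq]
  unfold wt
  refine Finset.sum_congr rfl fun i _ => ?_
  by_cases hi : (i : ℕ) < q <;> simp [ind, hi]

/-- rotated subspace -/
def BV (hqr : q ≤ r) (V : UG K r) : Submodule K (EuclideanSpace K (Fin r)) :=
  (Bq K hqr).map ((iso V).toLinearEquiv : EuclideanSpace K (Fin r) →ₗ[K] EuclideanSpace K (Fin r))

lemma wt_BV (hqr : q ≤ r) (V : UG K r) (y : EuclideanSpace K (Fin r)) :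
    wt (ind q) ((iso V).symm y) = ‖(BV hqr V).starProjection y‖ ^ 2 := by
  rw [wt_ind hqr]
  unfold BV
  rw [Submodule.starProjection_map_apply, LinearIsometryEquiv.norm_map]

lemma finrank_BV (hqr : q ≤ r) (V : UG K r) : Module.finrank K (BV hqr V) = r - q := by
  unfold BV
  rw [LinearEquiv.finrank_map_eq, finrank_Bq]

/-- Good position -/
def Good (q : ℕ) (L : Submodule K (EuclideanSpace K (Fin r))) (V : UG K r) : Prop :=
  ∀ w ∈ L, wt (ind q) ((iso V).symm w) = 0 → w = 0

lemma finrank_good (hqr : q ≤ r) (L : Submodule K (EuclideanSpace K (Fin r))) (V : UG K r)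
    (h : Good q L V) :
    Module.finrank K (BV hqr V ⊓ Lᗮ : Submodule K (EuclideanSpace K (Fin r))) =
      r - q - Module.finrank K L := by
  have h1 : (BV hqr V)ᗮ ⊓ L = ⊥ := by
    rw [eq_bot_iff]
    rintro w ⟨hw1, hw2⟩
    rw [Submodule.mem_bot]
    refine h w hw2 ?_
    rw [wt_BV hqr, (Submodule.starProjection_apply_eq_zero_iff _).2 hw1]
    simp
  have h2 : BV hqr V ⊓ Lᗮ = ((BV hqr V)ᗮ ⊔ L)ᗮ := by
    rw [← Submodule.inf_orthogonal, Submodule.orthogonal_orthogonal]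
  have h3 := Submodule.finrank_sup_add_finrank_inf_eq (BV hqr V)ᗮ L
  have h4 := Submodule.finrank_add_finrank_orthogonal ((BV hqr V)ᗮ ⊔ L)
  have h5 := Submodule.finrank_add_finrank_orthogonal (BV hqr V)
  rw [finrank_BV] at h5
  rw [h1, finrank_bot] at h3
  rw [h2]
  simp only [finrank_euclideanSpace, Fintype.card_fin] at h4 h5
  omega

lemma IsParam.continuous {X : Type*} [NormedAddCommGroup X] [InnerProductSpace K X]
    {E : Submodule K X} {N : ℕ} {J : EuclideanSpace ℝ (Fin N) → X} (hJ : IsParam E J) :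
    Continuous J := by
  have hs : ∀ x y, J (x - y) = J x - J y := by
    intro x y
    have := hJ.add (x - y) y
    rw [sub_add_cancel] at this
    rw [this]; abel
  have : Isometry J := by
    refine Isometry.of_dist_eq fun x y => ?_
    rw [dist_eq_norm, dist_eq_norm, ← hs, hJ.norm]
  exact this.continuous

lemma wt_ind_smul (c : Fin r → ℝ) (a : K) (y : EuclideanSpace K (Fin r)) :
    wt c (a • y) = ‖a‖ ^ 2 * wt c y := by
  unfold wt
  rw [Finset.mul_sum]
  refine Finset.sum_congr rfl fun i _ => ?_
  simp [mul_pow]; ring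

variable [MeasurableSpace K] [BorelSpace K]

lemma FF_measurable_swap (c : Fin r → ℝ) (L : Submodule K (EuclideanSpace K (Fin r))) {Z : Type*}
    [TopologicalSpace Z] [MeasurableSpace Z] [OpensMeasurableSpace Z] [SecondCountableTopology Z]
    (J : Z → EuclideanSpace K (Fin r)) (hJ : Continuous J) :
    Measurable fun p : Z × UG K r => FF c L p.2 (J p.1) := by
  have h : LowerSemicontinuous fun p : Z × UG K r => FF c L p.2 (J p.1) :=
    (FF_lsc c L).comp (g := fun p : Z × UG K r => (p.2, J p.1)) (by fun_prop)
  exact h.measurable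

lemma FF_value (hqr : q ≤ r) (L : Submodule K (EuclideanSpace K (Fin r)))
    (n : EuclideanSpace K (Fin r)) (hn : n ∈ Lᗮ) (hn1 : ‖n‖ = 1)
    (hG : ∀ᵐ V ∂(hU K r), Good q L V)
    (hd : 2 < Module.finrank ℝ K * (r - q - Module.finrank K L)) :
    ∫⁻ V, FF (ind q) L V n ∂(hU K r) = ENNReal.ofReal
      (((Module.finrank ℝ K * (r - Module.finrank K L) : ℕ) - 2 : ℝ) /
        ((Module.finrank ℝ K * (r - q - Module.finrank K L) : ℕ) - 2 : ℝ)) := by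
  obtain ⟨N, hN, J, hJ⟩ : ∃ N, N = Module.finrank ℝ K * Module.finrank K Lᗮ ∧
      ∃ J : EuclideanSpace ℝ (Fin N) → EuclideanSpace K (Fin r), IsParam Lᗮ J :=
    ⟨_, rfl, exists_param (K := K) Lᗮ⟩
  have hLo : Module.finrank K Lᗮ = r - Module.finrank K L := by
    have := Submodule.finrank_add_finrank_orthogonal L
    simp only [finrank_euclideanSpace, Fintype.card_fin] at this
    omega
  rw [← hLo, ← hN]
  set s := Module.finrank ℝ K * (r - q - Module.finrank K L) with hs
  have hsN : s ≤ N := by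
    rw [hs, hN, hLo]; exact Nat.mul_le_mul_left _ (by omega)
  set I := ∫⁻ V, FF (ind q) L V n ∂(hU K r) with hI
  have hFm' : Measurable fun p : EuclideanSpace ℝ (Fin N) × UG K r =>
      ENNReal.ofReal (Real.exp (-‖p.1‖ ^ 2)) * FF (ind q) L p.2 (J p.1) := by
    have h1 : Measurable fun p : EuclideanSpace ℝ (Fin N) × UG K r =>
        FF (ind q) L p.2 (J p.1) :=
      FF_measurable_swap _ _ J hJ.continuous
    have h2 : Measurable fun p : EuclideanSpace ℝ (Fin N) × UG K r =>
        ENNReal.ofReal (Real.exp (-‖p.1‖ ^ 2)) :=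
      ENNReal.measurable_ofReal.comp (Real.measurable_exp.comp
        ((measurable_norm.comp measurable_fst).pow_const 2).neg)
    exact h2.mul h1
  have hswap := lintegral_lintegral_swap (μ := (volume : Measure (EuclideanSpace ℝ (Fin N))))
    (ν := hU K r) (f := fun x V => ENNReal.ofReal (Real.exp (-‖x‖ ^ 2)) * FF (ind q) L V (J x))
    hFm'.aemeasurable
  have hN2 : 2 < N := by omega
  have : Nonempty (Fin N) := ⟨⟨0, by omega⟩⟩
  have hl : ∫⁻ x : EuclideanSpace ℝ (Fin N), ∫⁻ V, ENNReal.ofReal (Real.exp (-‖x‖ ^ 2)) *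
      FF (ind q) L V (J x) ∂(hU K r) = ENNReal.ofReal (Real.pi ^ ((N : ℝ) / 2) * (2 / ((N : ℝ) - 2))) * I := by
    have h0 := lintegral_gauss_inv (W := EuclideanSpace ℝ (Fin N)) (by simpa using hN2)
    simp only [finrank_euclideanSpace, Fintype.card_fin] at h0
    rw [← h0, ← lintegral_mul_const _ (by fun_prop)]
    refine lintegral_congr_ae ?_
    have hne : ∀ᵐ x : EuclideanSpace ℝ (Fin N), x ≠ 0 := Measure.ae_ne _ 0
    filter_upwards [hne] with x hx
    rw [lintegral_const_mul _ (FF_measurable_left _ _ _), FF_const (ind q) L n (J x) hn (hJ.mem x) hn1,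
      hJ.norm, mul_assoc]
    intro h
    apply hx
    rw [← norm_eq_zero, ← hJ.norm, h, norm_zero]
  have hr : ∫⁻ V, (∫⁻ x : EuclideanSpace ℝ (Fin N), ENNReal.ofReal (Real.exp (-‖x‖ ^ 2)) *
      FF (ind q) L V (J x)) ∂(hU K r) = ENNReal.ofReal (Real.pi ^ ((N : ℝ) / 2) * (2 / ((s : ℝ) - 2))) := by
    have : ∀ᵐ V ∂(hU K r), ∫⁻ x : EuclideanSpace ℝ (Fin N), ENNReal.ofReal (Real.exp (-‖x‖ ^ 2)) *
      FF (ind q) L V (J x) = ENNReal.ofReal (Real.pi ^ ((N : ℝ) / 2) * (2 / ((s : ℝ) - 2))) := by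
      filter_upwards [hG] with V hV
      have e1 : Module.finrank ℝ (paramPre hJ (BV hqr V)) = s := by
        rw [finrank_paramPre, finrank_good hqr L V hV]
      have h0 := lintegral_gauss_proj (paramPre hJ (BV hqr V)) (by rw [e1]; exact hd)
      rw [e1] at h0
      simp only [finrank_euclideanSpace, Fintype.card_fin] at h0
      rw [← h0]
      refine lintegral_congr fun x => ?_
      congr 1
      rw [← iSup_param]
      unfold FF
      simp_rw [wt_BV hqr]
    rw [lintegral_congr_ae this]
    simp
  rw [hl, hr] at hswap
  have hNr : (2 : ℝ) < N := by exact_mod_cast hN2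
  have hsr : (2 : ℝ) < s := by exact_mod_cast hd
  have hp : 0 < Real.pi ^ ((N : ℝ) / 2) := Real.rpow_pos_of_pos Real.pi_pos _
  have ha : 0 < Real.pi ^ ((N : ℝ) / 2) * (2 / ((N : ℝ) - 2)) :=
    mul_pos hp (div_pos two_pos (by linarith))
  have hfin : ENNReal.ofReal (Real.pi ^ ((N : ℝ) / 2) * (2 / ((N : ℝ) - 2))) ≠ ⊤ := ENNReal.ofReal_ne_top
  have hn0 : ENNReal.ofReal (Real.pi ^ ((N : ℝ) / 2) * (2 / ((N : ℝ) - 2))) ≠ 0 := by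
    simpa using ha
  rw [← ENNReal.mul_right_inj hn0 hfin, hswap, ← ENNReal.ofReal_mul ha.le]
  congr 1
  have : (N : ℝ) - 2 ≠ 0 := by linarith
  have : (s : ℝ) - 2 ≠ 0 := by linarith
  field_simp

lemma good_ae (hqr : q ≤ r) (k : ℕ) : ∀ (L : Submodule K (EuclideanSpace K (Fin r))),
    Module.finrank K L = k → 2 < Module.finrank ℝ K * (r - q - (k - 1)) →
    ∀ᵐ V ∂(hU K r), Good q L V := by
  induction k with
  | zero =>
    intro L hL _
    refine Eventually.of_forall fun V w hw _ => ?_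
    rw [Submodule.finrank_eq_zero] at hL
    rw [hL] at hw
    simpa using hw
  | succ k ih =>
    intro L hL hd
    have hpos : 0 < Module.finrank K L := by omega
    have hnt : Nontrivial L := Module.finrank_pos_iff.1 hpos
    let b := stdOrthonormalBasis K L
    let i0 : Fin (Module.finrank K L) := ⟨0, hpos⟩
    let n : EuclideanSpace K (Fin r) := b i0
    have hn1 : ‖n‖ = 1 := b.orthonormal.1 i0
    have hnL : n ∈ L := (b i0).2
    have hn0 : n ≠ 0 := by intro h; rw [h] at hn1; simp at hn1
    let L0 : Submodule K (EuclideanSpace K (Fin r)) := L ⊓ (K ∙ n)ᗮ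
    have hnL0 : n ∈ L0ᗮ := by
      rw [Submodule.mem_orthogonal]
      rintro u ⟨_, hu⟩
      rw [← inner_conj_symm, (Submodule.mem_orthogonal_singleton_iff_inner_right).1 hu, map_zero]
    have hdec : ∀ w ∈ L, ∃ a : K, ∃ w0 ∈ L0, w = a • n + w0 := by
      intro w hw
      refine ⟨inner K n w, w - (inner K n w : K) • n, ⟨?_, ?_⟩, by abel⟩
      · exact L.sub_mem hw (L.smul_mem _ hnL)
      · simp only [SetLike.mem_coe]
        rw [Submodule.mem_orthogonal_singleton_iff_inner_right, inner_sub_right, inner_smul_right,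
          inner_self_eq_norm_sq_to_K, hn1]
        simp
    have hL0 : Module.finrank K L0 = k := by
      have hle : (K ∙ n) ≤ L := by
        rw [Submodule.span_singleton_le_iff_mem]; exact hnL
      have := Submodule.finrank_add_inf_finrank_orthogonal hle
      rw [finrank_span_singleton hn0, inf_comm] at this
      change 1 + Module.finrank K L0 = _ at this
      omega
    have hd0 : 2 < Module.finrank ℝ K * (r - q - (k - 1)) :=
      lt_of_lt_of_le hd (Nat.mul_le_mul_left _ (by omega))
    have hG0 := ih L0 hL0 hd0
    have hv := FF_value hqr L0 n hnL0 hn1 hG0 (by rw [hL0]; exact hd)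
    have hfin : ∀ᵐ V ∂(hU K r), FF (ind q) L0 V n < ⊤ := by
      refine ae_lt_top (FF_measurable_left _ _ _) ?_
      rw [hv]; exact ENNReal.ofReal_ne_top
    filter_upwards [hG0, hfin] with V hV hVf
    intro w hw hw0
    obtain ⟨a, w0, hw0L, rfl⟩ := hdec w hw
    by_cases ha : a = 0
    · subst ha
      rw [zero_smul, zero_add] at hw0 ⊢
      exact hV w0 hw0L hw0
    · exfalso
      have e : a • n + w0 = a • (n - (-(a⁻¹ • w0))) := by
        rw [sub_neg_eq_add, smul_add, smul_inv_smul₀ ha]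
      rw [e, map_smul, wt_ind_smul] at hw0
      have h3 : wt (ind q) ((iso V).symm (n - (-(a⁻¹ • w0)))) = 0 := by
        rcases mul_eq_zero.1 hw0 with h | h
        · exact absurd (by simpa using h) ha
        · exact h
      have hm : -(a⁻¹ • w0) ∈ L0 := L0.neg_mem (L0.smul_mem _ hw0L)
      have h4 : (ENNReal.ofReal (wt (ind q) ((iso V).symm (n - (-(a⁻¹ • w0))))))⁻¹ ≤
          FF (ind q) L0 V n :=
        le_iSup (fun w : L0 => (ENNReal.ofReal (wt (ind q) ((iso V).symm (n - w))))⁻¹) ⟨_, hm⟩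
      rw [h3] at h4
      simp at h4
      exact hVf.ne h4

/-- Final form. -/
lemma FF_final {ℓ : ℕ} (hq : (q : ℝ) + alphaK K < (ℓ : ℝ)) (hℓr : ℓ < r)
    (L : Submodule K (EuclideanSpace K (Fin r))) (hL : Module.finrank K L = r - ℓ - 1)
    (n : EuclideanSpace K (Fin r)) (hn : n ∈ Lᗮ) (hn1 : ‖n‖ = 1) :
    ∫⁻ V, FF (ind q) L V n ∂(hU K r) =
      ENNReal.ofReal (1 + (q : ℝ) / ((ℓ : ℝ) - (q : ℝ) - alphaK K)) := by
  have hdK : (Module.finrank ℝ K : ℝ) = 2 - alphaK K := finrank_real_K K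
  have hα : alphaK K = 0 ∨ alphaK K = 1 := by
    unfold alphaK; split_ifs <;> simp
  have hα0 : 0 ≤ alphaK K := by rcases hα with h | h <;> rw [h] <;> norm_num
  have hqℓ : q < ℓ := by
    have : (q : ℝ) < ℓ := by linarith
    exact_mod_cast this
  have hqr : q ≤ r := by omega
  have hk : ((r - q - (r - ℓ - 1) : ℕ) : ℝ) = ℓ - q + 1 := by
    have : r - q - (r - ℓ - 1) = ℓ - q + 1 := by omega
    rw [this]; push_cast [Nat.cast_sub hqℓ.le]; ring
  have hk2 : ((r - (r - ℓ - 1) : ℕ) : ℝ) = ℓ + 1 := by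
    have : r - (r - ℓ - 1) = ℓ + 1 := by omega
    rw [this]; push_cast; ring
  have hd : 2 < Module.finrank ℝ K * (r - q - (r - ℓ - 1)) := by
    have : (2 : ℝ) < Module.finrank ℝ K * (r - q - (r - ℓ - 1) : ℕ) := by
      rw [hk, hdK]
      rcases hα with h | h <;> rw [h] at hq ⊢ <;> nlinarith
    exact_mod_cast this
  have hG := good_ae hqr (r - ℓ - 1) L hL
    (lt_of_lt_of_le hd (Nat.mul_le_mul_left _ (by omega)))
  rw [FF_value hqr L n hn hn1 hG (by rw [hL]; exact hd), hL]
  congr 1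
  push_cast
  rw [hk, hk2, hdK]
  rcases hα with h | h <;> rw [h] at hq ⊢
  · have h1 : (ℓ : ℝ) - q ≠ 0 := by linarith
    have h2 : (2 - 0 : ℝ) * ((ℓ : ℝ) - q + 1) - 2 ≠ 0 := by intro h; apply h1; linarith
    rw [div_eq_iff h2, sub_zero]
    field_simp
    ring
  · have h1 : (ℓ : ℝ) - q - 1 ≠ 0 := by linarith
    have h2 : (2 - 1) * ((ℓ : ℝ) - q + 1) - 2 ≠ 0 := by intro h; apply h1; linarith
    rw [div_eq_iff h2]
    field_simp
    ring

end value

/-! ### Linear algebra of the Nyström error -/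

section nys
set_option linter.unusedSectionVars false
variable {K : Type*} [RCLike K] {m n l : Type*} [Fintype m] [Fintype n] [Fintype l]
  [DecidableEq m] [DecidableEq n] [DecidableEq l]

lemma re_trace_gram_nonneg (A : Matrix m n K) : 0 ≤ RCLike.re (Aᴴ * A).trace :=
  (RCLike.nonneg_iff.1 (Matrix.posSemidef_conjTranspose_mul_self A).trace_nonneg).1

lemma nys_key (S : Matrix m n K) (Ω : Matrix n l K) (G : Matrix l l K)
    (hG : IsMoorePenrose (Ωᴴ * (Sᴴ * S) * Ω) G) :
    Ωᴴ * (Sᴴ * S) * (1 - Ω * (G * (Ωᴴ * (Sᴴ * S)))) = 0 := by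
  obtain ⟨h1, h2, h3, h4⟩ := hG
  set A := Ωᴴ * (Sᴴ * S) * Ω with hA
  have hAh : Aᴴ = A := by simp [hA, Matrix.conjTranspose_mul, Matrix.mul_assoc]
  have h5 : ((1 - A * G) * (Ωᴴ * Sᴴ)) * ((1 - A * G) * (Ωᴴ * Sᴴ))ᴴ = 0 := by
    have : ((1 - A * G) * (Ωᴴ * Sᴴ)) * ((1 - A * G) * (Ωᴴ * Sᴴ))ᴴ =
        ((1 - A * G) * A) * (1 - A * G)ᴴ := by
      rw [hA]; simp only [Matrix.conjTranspose_mul, Matrix.mul_assoc, Matrix.conjTranspose_conjTranspose]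
    rw [this, Matrix.sub_mul, Matrix.one_mul, h1, sub_self, Matrix.zero_mul]
  have h6 := Matrix.self_mul_conjTranspose_eq_zero.1 h5
  have : Ωᴴ * (Sᴴ * S) * (1 - Ω * (G * (Ωᴴ * (Sᴴ * S)))) = ((1 - A * G) * (Ωᴴ * Sᴴ)) * S := by
    rw [hA]; simp only [Matrix.mul_sub, Matrix.sub_mul, Matrix.mul_one, Matrix.one_mul, Matrix.mul_assoc]
  rw [this, h6, Matrix.zero_mul]

/-- the residual -/
lemma nys_residual (S : Matrix m n K) (Ω : Matrix n l K) (G : Matrix l l K)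
    (hG : IsMoorePenrose (Ωᴴ * (Sᴴ * S) * Ω) G) :
    (Sᴴ * S) - (Sᴴ * S) * Ω * (G * (Ωᴴ * (Sᴴ * S))) =
      (S * (1 - Ω * (G * (Ωᴴ * (Sᴴ * S)))))ᴴ * (S * (1 - Ω * (G * (Ωᴴ * (Sᴴ * S))))) := by
  have h := nys_key S Ω G hG
  set X := G * (Ωᴴ * (Sᴴ * S)) with hX
  have e : (S * (1 - Ω * X))ᴴ * (S * (1 - Ω * X)) =
      (Sᴴ * S) * (1 - Ω * X) - Xᴴ * (Ωᴴ * (Sᴴ * S) * (1 - Ω * X)) := by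
    simp only [Matrix.conjTranspose_mul, Matrix.conjTranspose_sub,
      Matrix.mul_sub, Matrix.sub_mul, Matrix.mul_one, Matrix.mul_assoc]
    abel
  rw [e, h, Matrix.mul_zero, sub_zero, Matrix.mul_sub, Matrix.mul_one, Matrix.mul_assoc]

lemma nys_min (S : Matrix m n K) (Ω : Matrix n l K) (G : Matrix l l K)
    (hG : IsMoorePenrose (Ωᴴ * (Sᴴ * S) * Ω) G) (X : Matrix l n K) :
    RCLike.re ((Sᴴ * S) - (Sᴴ * S) * Ω * (G * (Ωᴴ * (Sᴴ * S)))).trace ≤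
      RCLike.re ((S * (1 - Ω * X))ᴴ * (S * (1 - Ω * X))).trace := by
  have h := nys_key S Ω G hG
  rw [nys_residual S Ω G hG]
  set X0 := G * (Ωᴴ * (Sᴴ * S)) with hX
  have h' : (1 - Ω * X0)ᴴ * (Sᴴ * S) * Ω = 0 := by
    have := congrArg Matrix.conjTranspose h
    simpa only [Matrix.conjTranspose_mul, Matrix.conjTranspose_conjTranspose, Matrix.mul_assoc,
      Matrix.conjTranspose_zero] using this
  have e : (S * (1 - Ω * X))ᴴ * (S * (1 - Ω * X)) =
      (S * (1 - Ω * X0))ᴴ * (S * (1 - Ω * X0)) + (S * Ω * (X - X0))ᴴ * (S * Ω * (X - X0)) := by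
    have e1 : 1 - Ω * X = (1 - Ω * X0) - Ω * (X - X0) := by
      rw [Matrix.mul_sub]; abel
    set Y := 1 - Ω * X0 with hY
    set Z := X - X0 with hZ
    have e2 : (S * (Y - Ω * Z))ᴴ * (S * (Y - Ω * Z)) = (S * Y)ᴴ * (S * Y) + (S * Ω * Z)ᴴ * (S * Ω * Z)
        - (Yᴴ * (Sᴴ * S) * Ω) * Z - Zᴴ * (Ωᴴ * (Sᴴ * S) * Y) := by
      simp only [Matrix.conjTranspose_mul, Matrix.conjTranspose_sub,
        Matrix.mul_sub, Matrix.sub_mul, Matrix.mul_assoc]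
      abel
    rw [e1, e2, h, h', Matrix.zero_mul, Matrix.mul_zero, sub_zero, sub_zero]
  rw [e, Matrix.trace_add, map_add]
  linarith [re_trace_gram_nonneg (S * Ω * (X - X0))]

/-- compressions decrease the trace -/
lemma trace_compress (T : Matrix m n K) (N : Matrix n l K) (hN : Nᴴ * N = 1) :
    RCLike.re (Nᴴ * (Tᴴ * T) * N).trace ≤ RCLike.re (Tᴴ * T).trace := by
  have h := re_trace_gram_nonneg (T * (1 - N * Nᴴ))
  have e : ((T * (1 - N * Nᴴ))ᴴ * (T * (1 - N * Nᴴ))).trace =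
      (Tᴴ * T).trace - (Nᴴ * (Tᴴ * T) * N).trace := by
    have e1 : (T * (1 - N * Nᴴ))ᴴ = (1 - N * Nᴴ) * Tᴴ := by
      simp [Matrix.conjTranspose_mul]
    have e2 : (1 - N * Nᴴ) * (1 - N * Nᴴ) = 1 - N * Nᴴ := by
      have : N * Nᴴ * (N * Nᴴ) = N * Nᴴ := by
        rw [Matrix.mul_assoc, ← Matrix.mul_assoc Nᴴ, hN, Matrix.one_mul]
      simp [Matrix.mul_sub, Matrix.sub_mul, this]
    have e3 : (Tᴴ * T * (N * Nᴴ)).trace = (Nᴴ * (Tᴴ * T) * N).trace := by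
      rw [← Matrix.mul_assoc, Matrix.trace_mul_comm, ← Matrix.mul_assoc]
    rw [e1, Matrix.mul_assoc, Matrix.trace_mul_comm, ← Matrix.mul_assoc, Matrix.mul_assoc _ (1 - _), e2,
      Matrix.mul_sub, Matrix.mul_one, Matrix.trace_sub, e3]
  rw [e, map_sub] at h
  linarith

/-- weighted Cauchy–Schwarz -/
lemma weighted_cs (d : m → ℝ) (hd : ∀ i, 0 < d i) (a b : m → K) :
    ‖star a ⬝ᵥ b‖ ^ 2 ≤ (∑ i, (d i)⁻¹ * ‖a i‖ ^ 2) * ∑ i, d i * ‖b i‖ ^ 2 := by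
  have h1 : ‖star a ⬝ᵥ b‖ ≤ ∑ i, ‖a i‖ * ‖b i‖ := by
    unfold dotProduct
    refine (norm_sum_le _ _).trans (Finset.sum_le_sum fun i _ => ?_)
    simp
  calc ‖star a ⬝ᵥ b‖ ^ 2 ≤ (∑ i, ‖a i‖ * ‖b i‖) ^ 2 := by gcongr
    _ ≤ _ := by
      refine Finset.sum_sq_le_sum_mul_sum_of_sq_le_mul _ ?_ ?_ ?_
      · intro i _; have := hd i; positivity
      · intro i _; have := hd i; positivity
      · intro i _; have := (hd i).ne'; refine le_of_eq ?_; field_simp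

end nys

/-! ### The test matrices -/

section test
variable {K : Type*} [RCLike K] {n r l : ℕ}

lemma frobSq_eq {m n : Type*} [Fintype m] [Fintype n] (A : Matrix m n K) :
    frobSq A = RCLike.re (Aᴴ * A).trace := by
  unfold frobSq
  rw [Finset.sum_comm]
  simp only [Matrix.trace, Matrix.diag, Matrix.mul_apply, Matrix.conjTranspose_apply, map_sum]
  refine Finset.sum_congr rfl fun i _ => Finset.sum_congr rfl fun j _ => ?_
  simp [RCLike.conj_mul]

/-- square-root factor -/
def SM (d : Fin r → ℝ) (U : Matrix (Fin n) (Fin r) K) : Matrix (Fin r) (Fin n) K :=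
  Matrix.diagonal (fun i => ((√(d i) : ℝ) : K)) * Uᴴ

lemma HM_eq (d : Fin r → ℝ) (hd : ∀ i, 0 ≤ d i) (U : Matrix (Fin n) (Fin r) K) :
    (SM d U)ᴴ * SM d U = U * Matrix.diagonal (fun i => ((d i : ℝ) : K)) * Uᴴ := by
  unfold SM
  rw [Matrix.conjTranspose_mul, Matrix.diagonal_conjTranspose, Matrix.conjTranspose_conjTranspose,
    Matrix.mul_assoc, ← Matrix.mul_assoc (Matrix.diagonal _), Matrix.diagonal_mul_diagonal,
    ← Matrix.mul_assoc]
  congr 2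
  congr 1
  funext i
  simp only [Pi.star_apply, RCLike.star_def, RCLike.conj_ofReal]
  rw [← RCLike.ofReal_mul, Real.mul_self_sqrt (hd i)]

lemma quad_lower (d : Fin r → ℝ) (hd : ∀ i, 0 < d i) (U : Matrix (Fin n) (Fin r) K)
    (Ω : Matrix (Fin n) (Fin l) K) (X : Matrix (Fin l) (Fin n) K) (y : Fin r → K)
    (hy : Ωᴴ *ᵥ (U *ᵥ y) = 0) (u : Fin n → K) :
    ‖star (U *ᵥ y) ⬝ᵥ u‖ ^ 2 ≤ (∑ i, (d i)⁻¹ * ‖y i‖ ^ 2) *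
      ∑ i, ‖((SM d U * (1 - Ω * X)) *ᵥ u) i‖ ^ 2 := by
  have h1 : star (U *ᵥ y) ⬝ᵥ u = star y ⬝ᵥ (Uᴴ *ᵥ ((1 - Ω * X) *ᵥ u)) := by
    rw [Matrix.dotProduct_mulVec, ← Matrix.star_mulVec, Matrix.sub_mulVec, Matrix.one_mulVec,
      dotProduct_sub, ← Matrix.mulVec_mulVec, Matrix.dotProduct_mulVec _ Ω]
    have : star (U *ᵥ y) ᵥ* Ω = 0 := by
      have := Matrix.star_mulVec Ωᴴ (U *ᵥ y)
      rw [hy, Matrix.conjTranspose_conjTranspose, star_zero] at this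
      exact this.symm
    rw [this]; simp
  rw [h1]
  refine (weighted_cs d hd _ _).trans (le_of_eq ?_)
  congr 1
  refine Finset.sum_congr rfl fun i _ => ?_
  unfold SM
  rw [Matrix.mul_assoc, ← Matrix.mulVec_mulVec, Matrix.mulVec_diagonal, ← Matrix.mulVec_mulVec,
    norm_mul, mul_pow, RCLike.norm_ofReal, sq_abs, Real.sq_sqrt (hd i).le]

/-- coordinate embedding -/
def F0 (K : Type*) [RCLike K] (hrn : r ≤ n) : Matrix (Fin n) (Fin r) K :=
  Matrix.of fun i j => if i = Fin.castLE hrn j then 1 else 0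

lemma F0_gram (hrn : r ≤ n) : (F0 K hrn)ᴴ * F0 K hrn = 1 := by
  ext i j
  simp only [Matrix.mul_apply, F0, Matrix.conjTranspose_apply, Matrix.of_apply, Matrix.one_apply]
  simp only [apply_ite star, star_one, star_zero, mul_ite, mul_one, mul_zero]
  rw [Finset.sum_ite_eq']
  simp [eq_comm]

/-- The rotated frame. -/
def UM (hrn : r ≤ n) (V : UG K r) : Matrix (Fin n) (Fin r) K := F0 K hrn * V.1

lemma UM_gram (hrn : r ≤ n) (V : UG K r) : (UM hrn V)ᴴ * UM hrn V = 1 := by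
  unfold UM
  have : V.1ᴴ * V.1 = 1 := (Unitary.mem_iff.1 V.2).1
  rw [Matrix.conjTranspose_mul, Matrix.mul_assoc, ← Matrix.mul_assoc _ (F0 K hrn), F0_gram,
    Matrix.one_mul, this]

/-- frame for the complement of the range of the embedding -/
lemma exists_frame (hrn : r ≤ n) (Ω : Matrix (Fin n) (Fin l) K) :
    ∃ (v : Fin (r - l) → EuclideanSpace K (Fin r))
      (L : Fin (r - l) → Submodule K (EuclideanSpace K (Fin r))),
      Orthonormal K v ∧ (∀ i, v i ∈ (L i)ᗮ) ∧ (∀ i, Module.finrank K (L i) = r - l - 1) ∧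
      (∀ i, Ωᴴ *ᵥ (F0 K hrn *ᵥ (v i).ofLp) = 0) ∧
      (∀ i, ∀ w ∈ L i, Ωᴴ *ᵥ (F0 K hrn *ᵥ w.ofLp) = 0) := by
  classical
  let f : EuclideanSpace K (Fin r) →ₗ[K] (Fin l → K) :=
    (Matrix.mulVecLin (Ωᴴ * F0 K hrn)) ∘ₗ (WithLp.linearEquiv 2 K (Fin r → K)).toLinearMap
  have hf : ∀ w, f w = Ωᴴ *ᵥ (F0 K hrn *ᵥ w.ofLp) := by
    intro w
    rw [Matrix.mulVec_mulVec]; rfl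
  let W := LinearMap.ker f
  have hW : r - l ≤ Module.finrank K W := by
    have h := LinearMap.finrank_range_add_finrank_ker f
    have h2 : Module.finrank K (LinearMap.range f) ≤ l := by
      have := Submodule.finrank_le (LinearMap.range f)
      simpa using this
    simp only [finrank_euclideanSpace, Fintype.card_fin] at h
    change _ + Module.finrank K W = _ at h
    omega
  let b := stdOrthonormalBasis K W
  let v : Fin (r - l) → EuclideanSpace K (Fin r) := fun i => (b (Fin.castLE hW i) : W)
  have hv : Orthonormal K v :=
    (b.orthonormal.comp_linearIsometry W.subtypeₗᵢ).comp _ (Fin.castLE_injective hW)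
  have hvW : ∀ i, v i ∈ W := fun i => (b (Fin.castLE hW i)).2
  let L : Fin (r - l) → Submodule K (EuclideanSpace K (Fin r)) :=
    fun i => Submodule.span K (Set.range fun j : {j // j ≠ i} => v j)
  have hL : ∀ i, L i ≤ W := by
    intro i
    rw [Submodule.span_le]
    rintro _ ⟨j, rfl⟩
    exact hvW j
  refine ⟨v, L, hv, ?_, ?_, ?_, ?_⟩
  · intro i
    rw [Submodule.mem_orthogonal]
    intro u hu
    refine Submodule.span_induction (p := fun u _ => inner K u (v i) = 0) ?_ ?_ ?_ ?_ hu
    · rintro _ ⟨j, rfl⟩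
      exact hv.2 j.2
    · simp
    · intro x y _ _ hx hy; rw [inner_add_left, hx, hy, add_zero]
    · intro a x _ hx; rw [inner_smul_left, hx, mul_zero]
  · intro i
    have hli : LinearIndependent K fun j : {j // j ≠ i} => v j :=
      hv.linearIndependent.comp _ Subtype.val_injective
    have := finrank_span_eq_card hli
    rw [Fintype.card_subtype_compl] at this
    simpa using this
  · intro i; rw [← hf]; exact hvW i
  · intro i w hw; rw [← hf]; exact hL i hw

/-- the lower bound on the error -/
lemma err_lower (hrn : r ≤ n) (Ω : Matrix (Fin n) (Fin l) K)
    (v : Fin (r - l) → EuclideanSpace K (Fin r))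
    (L : Fin (r - l) → Submodule K (EuclideanSpace K (Fin r)))
    (hv : Orthonormal K v) (hvL : ∀ i, v i ∈ (L i)ᗮ)
    (h1 : ∀ i, Ωᴴ *ᵥ (F0 K hrn *ᵥ (v i).ofLp) = 0)
    (h2 : ∀ i, ∀ w ∈ L i, Ωᴴ *ᵥ (F0 K hrn *ᵥ w.ofLp) = 0)
    (d : Fin r → ℝ) (hd : ∀ i, 0 < d i) (V : UG K r) (X : Matrix (Fin l) (Fin n) K) :
    ∑ i, FF (fun j => (d j)⁻¹) (L i) V (v i) ≤ ENNReal.ofReal (RCLike.re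
      ((SM d (UM hrn V) * (1 - Ω * X))ᴴ * (SM d (UM hrn V) * (1 - Ω * X))).trace) := by
  set T := SM d (UM hrn V) * (1 - Ω * X) with hT
  let Vm : Matrix (Fin r) (Fin (r - l)) K := Matrix.of fun j i => v i j
  let N := F0 K hrn * Vm
  have hVm : Vmᴴ * Vm = 1 := by
    ext i j
    have := (orthonormal_iff_ite.1 hv) i j
    rw [Matrix.one_apply, ← this, EuclideanSpace.inner_eq_star_dotProduct]
    simp [Matrix.mul_apply, dotProduct, Vm, mul_comm]
  have hN : Nᴴ * N = 1 := by
    simp only [N]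
    rw [Matrix.conjTranspose_mul, Matrix.mul_assoc, ← Matrix.mul_assoc _ (F0 K hrn), F0_gram,
      Matrix.one_mul, hVm]
  have hNT : Nᴴ * (Tᴴ * T) * N = (T * N)ᴴ * (T * N) := by
    simp only [Matrix.conjTranspose_mul, Matrix.mul_assoc]
  have hc := trace_compress T N hN
  rw [hNT, ← frobSq_eq] at hc
  have hcol : ∀ i j, (T * N) j i = (T *ᵥ (F0 K hrn *ᵥ (v i).ofLp)) j := by
    intro i j
    rw [Matrix.mul_apply]
    simp only [Matrix.mulVec, dotProduct, N, Matrix.mul_apply, Vm, Matrix.of_apply]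
  unfold frobSq at hc
  rw [Finset.sum_comm] at hc
  refine le_trans ?_ (ENNReal.ofReal_le_ofReal hc)
  rw [ENNReal.ofReal_sum_of_nonneg (fun i _ => by positivity)]
  refine Finset.sum_le_sum fun i _ => ?_
  unfold FF
  refine iSup_le fun w => ?_
  have hw : inner K (w : EuclideanSpace K (Fin r)) (v i) = 0 := hvL i w w.2
  have hsymm : (iso V).symm (v i - w) = WithLp.toLp 2 (V.1ᴴ *ᵥ (v i - w).ofLp) := iso_symm_apply _ _
  have hVV : V.1 * V.1ᴴ = 1 := (Unitary.mem_iff.1 V.2).2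
  have hUy : UM hrn V *ᵥ (V.1ᴴ *ᵥ (v i - w).ofLp) = F0 K hrn *ᵥ (v i - w).ofLp := by
    unfold UM
    rw [Matrix.mulVec_mulVec, Matrix.mul_assoc, hVV, Matrix.mul_one]
  have hq := quad_lower d hd (UM hrn V) Ω X (V.1ᴴ *ᵥ (v i - w).ofLp)
    (by rw [hUy, WithLp.ofLp_sub, Matrix.mulVec_sub, Matrix.mulVec_sub, h1, h2 i w w.2, sub_zero])
    (F0 K hrn *ᵥ (v i).ofLp)
  have hin : star (F0 K hrn *ᵥ (v i - w).ofLp) ⬝ᵥ (F0 K hrn *ᵥ (v i).ofLp) = 1 := by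
    rw [Matrix.star_mulVec, ← Matrix.dotProduct_mulVec, Matrix.mulVec_mulVec, F0_gram,
      Matrix.one_mulVec, dotProduct_comm, ← EuclideanSpace.inner_eq_star_dotProduct, inner_sub_left, hw,
      inner_self_eq_norm_sq_to_K, hv.1 i]
    simp
  rw [hUy, hin, norm_one, one_pow] at hq
  have hwt : wt (fun j => (d j)⁻¹) ((iso V).symm (v i - w)) =
      ∑ j, (d j)⁻¹ * ‖(V.1ᴴ *ᵥ (v i - w).ofLp) j‖ ^ 2 := by
    rw [hsymm]; rfl
  rw [hwt]
  simp_rw [hcol]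
  set a := ∑ j, (d j)⁻¹ * ‖(V.1ᴴ *ᵥ (v i - w).ofLp) j‖ ^ 2
  have ha : 0 ≤ a := Finset.sum_nonneg fun j _ => by have := hd j; positivity
  rw [ENNReal.inv_le_iff_le_mul]
  · rw [← ENNReal.ofReal_mul ha]
    exact ENNReal.one_le_ofReal.2 hq
  · intro h; exact absurd h ENNReal.ofReal_ne_top
  · intro h; exact absurd h ENNReal.ofReal_ne_top

end test

/-! ### Best low-rank approximation of the test matrices -/

section approx
variable {K : Type*} [RCLike K] {n r l q : ℕ}

lemma frob_pythagoras {m k : Type*} [Fintype m] [Fintype k] [DecidableEq m]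
    (P : Matrix m m K) (hP : Pᴴ = P) (hPP : P * P = P) (A : Matrix m k K) :
    frobSq A = frobSq (P * A) + frobSq ((1 - P) * A) := by
  rw [frobSq_eq, frobSq_eq, frobSq_eq, ← map_add, ← Matrix.trace_add]
  congr 2
  have h1 : (P * A)ᴴ * (P * A) = Aᴴ * (P * A) := by
    rw [Matrix.conjTranspose_mul, hP, Matrix.mul_assoc, ← Matrix.mul_assoc P, hPP]
  have h2 : ((1 - P) * A)ᴴ * ((1 - P) * A) = Aᴴ * A - Aᴴ * (P * A) := by
    have : (1 - P) * (1 - P) = 1 - P := by simp [Matrix.mul_sub, Matrix.sub_mul, hPP]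
    rw [Matrix.conjTranspose_mul, Matrix.conjTranspose_sub, hP, Matrix.conjTranspose_one,
      Matrix.mul_assoc, ← Matrix.mul_assoc (1 - P), this, Matrix.sub_mul, Matrix.one_mul, Matrix.mul_sub]
  rw [h1, h2]; abel

lemma frobSq_nonneg {m k : Type*} [Fintype m] [Fintype k] (A : Matrix m k K) : 0 ≤ frobSq A :=
  Finset.sum_nonneg fun _ _ => Finset.sum_nonneg fun _ _ => by positivity

lemma trace_idem (P : Matrix (Fin n) (Fin n) K) (hPP : P * P = P) :
    P.trace = (P.rank : K) := by
  have h : IsIdempotentElem (Matrix.toLin' P) := by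
    unfold IsIdempotentElem
    rw [Module.End.mul_eq_comp, ← Matrix.toLin'_mul, hPP]
  rw [← Matrix.trace_toLin'_eq, (LinearMap.IsIdempotentElem.isProj_range _ h).trace]
  rfl

/-- the test eigenvalues -/
def dt (q : ℕ) (t : ℝ) (i : Fin r) : ℝ := if (i : ℕ) < q then t else 1

/-- the leading test eigenvalues -/
def dq (q : ℕ) (t : ℝ) (i : Fin r) : ℝ := if (i : ℕ) < q then t else 0

/-- conjugated diagonal matrix -/
def CD (U : Matrix (Fin n) (Fin r) K) (d : Fin r → ℝ) : Matrix (Fin n) (Fin n) K :=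
  U * Matrix.diagonal (fun i => ((d i : ℝ) : K)) * Uᴴ

lemma sum_ind (hqr : q ≤ r) : ∑ i : Fin r, ind q i = (r : ℝ) - q := by
  have h : ∀ i : Fin r, ind q i = 1 - if (i : ℕ) < q then 1 else 0 := by
    intro i; unfold ind; split_ifs <;> simp
  simp_rw [h]
  rw [Finset.sum_sub_distrib, Finset.sum_boole, Fin.card_filter_val_lt, min_eq_right hqr]
  simp

lemma CD_sub (U : Matrix (Fin n) (Fin r) K) (t : ℝ) :
    CD U (dt q t) - CD U (dq q t) = CD U (ind q) := by
  unfold CD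
  rw [← Matrix.sub_mul, ← Matrix.mul_sub, Matrix.diagonal_sub]
  congr 3
  funext i
  unfold dt dq ind
  split_ifs <;> simp

lemma trace_CD (U : Matrix (Fin n) (Fin r) K) (hU : Uᴴ * U = 1) (d : Fin r → ℝ) :
    RCLike.re (CD U d).trace = ∑ i, d i := by
  unfold CD
  rw [Matrix.mul_assoc, Matrix.trace_mul_comm, Matrix.mul_assoc, hU, Matrix.mul_one,
    Matrix.trace_diagonal, map_sum]
  simp

lemma frobSq_CD_left (U : Matrix (Fin n) (Fin r) K) (hU : Uᴴ * U = 1) (d : Fin r → ℝ)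
    (Q : Matrix (Fin n) (Fin n) K) :
    frobSq (Q * CD U d) = ∑ i, ∑ j, ‖(Q * U) i j‖ ^ 2 * (d j) ^ 2 := by
  have h1 : Q * CD U d = (Q * U * Matrix.diagonal (fun i => ((d i : ℝ) : K))) * Uᴴ := by
    unfold CD; simp only [Matrix.mul_assoc]
  have h2 : frobSq (Q * CD U d) = frobSq (Q * U * Matrix.diagonal (fun i => ((d i : ℝ) : K))) := by
    rw [h1, frobSq_eq, frobSq_eq]
    congr 1
    rw [Matrix.conjTranspose_mul, Matrix.trace_mul_comm, Matrix.conjTranspose_conjTranspose,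
      Matrix.mul_assoc, ← Matrix.mul_assoc Uᴴ, hU, Matrix.one_mul, Matrix.trace_mul_comm]
  rw [h2]
  unfold frobSq
  refine Finset.sum_congr rfl fun i _ => Finset.sum_congr rfl fun j _ => ?_
  rw [Matrix.mul_diagonal, norm_mul, mul_pow, RCLike.norm_ofReal, sq_abs]

lemma CD_best (hqr : q ≤ r) (U : Matrix (Fin n) (Fin r) K) (hU : Uᴴ * U = 1) (t : ℝ) (ht : 1 ≤ t)
    (hp : ∀ B : Matrix (Fin n) (Fin n) K, ∃ X, IsMoorePenrose B X) :
    IsBestRankApprox q (CD U (dt q t)) (CD U (dq q t)) := by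
  classical
  refine ⟨?_, ?_⟩
  · unfold CD
    refine (Matrix.rank_mul_le_left _ _).trans ((Matrix.rank_mul_le_right _ _).trans ?_)
    rw [Matrix.rank_diagonal, Fintype.card_subtype]
    calc _ ≤ (Finset.univ.filter fun i : Fin r => (i : ℕ) < q).card := by
          refine Finset.card_le_card fun i => ?_
          simp only [Finset.mem_filter, Finset.mem_univ, true_and]
          intro h
          by_contra h2
          apply h
          simp [dq, h2]
      _ ≤ q := by rw [Fin.card_filter_val_lt]; exact min_le_right _ _
  · intro B hB
    have hl : frobSq (CD U (dt q t) - CD U (dq q t)) = (r : ℝ) - q := by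
      rw [CD_sub, frobSq_eq]
      have : (CD U (ind q))ᴴ * CD U (ind q) = CD U (ind q) := by
        unfold CD
        rw [Matrix.conjTranspose_mul, Matrix.conjTranspose_mul, Matrix.conjTranspose_conjTranspose,
          Matrix.diagonal_conjTranspose]
        have h1 : ∀ D E : Matrix (Fin r) (Fin r) K, U * (D * Uᴴ) * (U * E * Uᴴ) =
            U * (D * E) * Uᴴ := by
          intro D E
          calc U * (D * Uᴴ) * (U * E * Uᴴ) = U * (D * ((Uᴴ * U) * (E * Uᴴ))) := by
                simp only [Matrix.mul_assoc]
            _ = _ := by rw [hU, Matrix.one_mul]; simp only [Matrix.mul_assoc]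
        rw [h1, Matrix.diagonal_mul_diagonal]
        congr 3
        funext i
        unfold ind
        by_cases hi : (i : ℕ) < q <;> simp [hi]
      rw [this, trace_CD U hU, sum_ind hqr]
    rw [hl]
    obtain ⟨X, hX1, hX2, hX3, hX4⟩ := hp B
    set P := B * X with hPdef
    have hPB : P * B = B := hX1
    have hPP : P * P = P := by rw [hPdef, ← Matrix.mul_assoc, hX1]
    have hPr : P.rank ≤ q := (Matrix.rank_mul_le_left _ _).trans hB
    have e1 := frob_pythagoras P hX3 hPP (CD U (dt q t) - B)
    have e2 : (1 - P) * (CD U (dt q t) - B) = (1 - P) * CD U (dt q t) := by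
      rw [Matrix.mul_sub, Matrix.sub_mul 1 P B, hPB, Matrix.one_mul, sub_self, sub_zero]
    rw [e2, frobSq_CD_left U hU] at e1
    have e3 : frobSq ((1 - P) * U) ≤ ∑ i, ∑ j, ‖((1 - P) * U : Matrix (Fin n) (Fin r) K) i j‖ ^ 2 * (dt q t j) ^ 2 := by
      unfold frobSq
      refine Finset.sum_le_sum fun i _ => Finset.sum_le_sum fun j _ => ?_
      have : 1 ≤ dt q t j := by unfold dt; split_ifs <;> linarith
      have : 1 ≤ dt q t j ^ 2 := by nlinarith
      nlinarith [sq_nonneg ‖((1 - P) * U : Matrix (Fin n) (Fin r) K) i j‖]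
    have e4 := frob_pythagoras P hX3 hPP U
    have e5 : frobSq U = r := by
      rw [frobSq_eq, hU, Matrix.trace_one]; simp
    have e6 : frobSq (P * U) ≤ q := by
      have h := trace_compress P U hU
      have h2 : Uᴴ * (Pᴴ * P) * U = (P * U)ᴴ * (P * U) := by
        simp only [Matrix.conjTranspose_mul, Matrix.mul_assoc]
      rw [h2, ← frobSq_eq, hX3, hPP, trace_idem P hPP] at h
      have h3 : RCLike.re ((P.rank : ℕ) : K) = (P.rank : ℝ) := by simp
      rw [h3] at h
      exact h.trans (by exact_mod_cast hPr)
    have e7 := frobSq_nonneg (P * (CD U (dt q t) - B))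
    linarith

lemma CD_rank (U : Matrix (Fin n) (Fin r) K) (hU : Uᴴ * U = 1) (d : Fin r → ℝ) (hd : ∀ i, 0 < d i) :
    (CD U d).rank = r := by
  classical
  apply le_antisymm
  · unfold CD
    exact (Matrix.rank_mul_le_left _ _).trans ((Matrix.rank_mul_le_left _ _).trans U.rank_le_width)
  · have h : Uᴴ * CD U d * U = Matrix.diagonal (fun i => ((d i : ℝ) : K)) := by
      unfold CD
      calc _ = (Uᴴ * U) * Matrix.diagonal (fun i => ((d i : ℝ) : K)) * (Uᴴ * U) := by
            simp only [Matrix.mul_assoc]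
        _ = _ := by rw [hU, Matrix.one_mul, Matrix.mul_one]
    have h2 : (Matrix.diagonal (fun i => ((d i : ℝ) : K))).rank = r := by
      rw [Matrix.rank_diagonal, Fintype.card_subtype]
      rw [Finset.filter_true_of_mem]
      · simp
      · intro i _
        exact_mod_cast (hd i).ne'
    refine h2.symm.le.trans ?_
    rw [← h]
    exact (Matrix.rank_mul_le_left _ _).trans (Matrix.rank_mul_le_right _ _)

end approx

section meas
set_option linter.unusedSectionVars false
variable {K : Type*} [RCLike K] {n r l q : ℕ} [MeasurableSpace K] [BorelSpace K]

/-- The Nyström error as an extended nonnegative number -/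
def errE (pinv : Matrix (Fin l) (Fin l) K → Matrix (Fin l) (Fin l) K)
    (H : Matrix (Fin n) (Fin n) K) (Ω : Matrix (Fin n) (Fin l) K) : ℝ≥0∞ :=
  ENNReal.ofReal (RCLike.re (Matrix.trace
            (H - H * Ω * (pinv (Ωᴴ * H * Ω) * (Ωᴴ * H)))))

lemma errE_eq (pinv : Matrix (Fin l) (Fin l) K → Matrix (Fin l) (Fin l) K)
    (hpinv : ∀ A, IsMoorePenrose A (pinv A)) (S : Matrix (Fin r) (Fin n) K)
    (Ω : Matrix (Fin n) (Fin l) K) :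
    errE pinv (Sᴴ * S) Ω =
      ⨅ X : Matrix (Fin l) (Fin n) K, ENNReal.ofReal (RCLike.re
        ((S * (1 - Ω * X))ᴴ * (S * (1 - Ω * X))).trace) := by
  apply le_antisymm
  · exact le_iInf fun X => ENNReal.ofReal_le_ofReal (nys_min S Ω _ (hpinv _) X)
  · refine (iInf_le _ (pinv (Ωᴴ * (Sᴴ * S) * Ω) * (Ωᴴ * (Sᴴ * S)))).trans ?_
    rw [← nys_residual S Ω _ (hpinv _)]
    exact le_rfl

lemma errE_measurable (pinv : Matrix (Fin l) (Fin l) K → Matrix (Fin l) (Fin l) K)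
    (hpinv : ∀ A, IsMoorePenrose A (pinv A)) (hrn : r ≤ n) (d : Fin r → ℝ) :
    Measurable fun p : UG K r × Matrix (Fin n) (Fin l) K =>
      errE pinv ((SM d (UM hrn p.1))ᴴ * SM d (UM hrn p.1)) p.2 := by
  have h : UpperSemicontinuous fun p : UG K r × Matrix (Fin n) (Fin l) K =>
      errE pinv ((SM d (UM hrn p.1))ᴴ * SM d (UM hrn p.1)) p.2 := by
    simp_rw [errE_eq pinv hpinv]
    refine upperSemicontinuous_iInf fun X => Continuous.upperSemicontinuous ?_
    refine ENNReal.continuous_ofReal.comp (RCLike.continuous_re.comp ?_)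
    unfold SM UM
    fun_prop
  exact h.measurable

end meas

section final
variable {K : Type*} [RCLike K] {n r l q : ℕ}

lemma FF_le_iSup (L : Submodule K (EuclideanSpace K (Fin r))) (V : UG K r)
    (g : EuclideanSpace K (Fin r)) :
    FF (ind q) L V g ≤ ⨆ k : ℕ, FF (fun j => (dt q ((k : ℝ) + 1) j)⁻¹) L V g := by
  refine iSup_le fun w => ?_
  set y := (iso V).symm (g - w) with hy
  have h1 : Tendsto (fun k : ℕ => wt (fun j => (dt q ((k : ℝ) + 1) j)⁻¹) y) atTop
      (𝓝 (wt (ind q) y)) := by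
    unfold wt
    refine tendsto_finsetSum _ fun i _ => Tendsto.mul_const _ ?_
    by_cases hi : (i : ℕ) < q
    · have := tendsto_one_div_add_atTop_nhds_zero_nat (𝕜 := ℝ)
      simpa [dt, ind, hi] using this
    · simp [dt, ind, hi]
  have h2 : Tendsto (fun k : ℕ => (ENNReal.ofReal (wt (fun j => (dt q ((k : ℝ) + 1) j)⁻¹) y))⁻¹)
      atTop (𝓝 (ENNReal.ofReal (wt (ind q) y))⁻¹) :=
    ((continuous_inv.comp ENNReal.continuous_ofReal).tendsto _).comp h1
  refine le_of_tendsto' h2 fun k => ?_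
  refine le_trans ?_ (le_iSup _ k)
  exact le_iSup (fun w : L => (ENNReal.ofReal (wt (fun j => (dt q ((k : ℝ) + 1) j)⁻¹)
    ((iso V).symm (g - w))))⁻¹) w

lemma FF_mono (L : Submodule K (EuclideanSpace K (Fin r))) (V : UG K r)
    (g : EuclideanSpace K (Fin r)) :
    Monotone fun k : ℕ => FF (fun j => (dt q ((k : ℝ) + 1) j)⁻¹) L V g := by
  intro a b hab
  refine iSup_mono fun w => ENNReal.inv_le_inv.2 (ENNReal.ofReal_le_ofReal ?_)
  unfold wt
  refine Finset.sum_le_sum fun i _ => mul_le_mul_of_nonneg_right ?_ (by positivity)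
  have hab' : (a : ℝ) ≤ b := by exact_mod_cast hab
  by_cases hi : (i : ℕ) < q
  · simp only [dt, hi, if_true]
    gcongr
  · simp only [dt, hi, if_false, le_refl]

lemma sum_FF_le_liminf {ι : Type*} [Fintype ι] (L : ι → Submodule K (EuclideanSpace K (Fin r)))
    (V : UG K r) (g : ι → EuclideanSpace K (Fin r)) (f : ℕ → ℝ≥0∞)
    (hf : ∀ k : ℕ, ∑ i, FF (fun j => (dt q ((k : ℝ) + 1) j)⁻¹) (L i) V (g i) ≤ f k) :
    ∑ i, FF (ind q) (L i) V (g i) ≤ liminf f atTop := by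
  have h1 : Tendsto (fun k : ℕ => ∑ i, FF (fun j => (dt q ((k : ℝ) + 1) j)⁻¹) (L i) V (g i)) atTop
      (𝓝 (∑ i, ⨆ k : ℕ, FF (fun j => (dt q ((k : ℝ) + 1) j)⁻¹) (L i) V (g i))) :=
    tendsto_finsetSum _ fun i _ => tendsto_atTop_iSup (FF_mono (L i) V (g i))
  calc _ ≤ ∑ i, ⨆ k : ℕ, FF (fun j => (dt q ((k : ℝ) + 1) j)⁻¹) (L i) V (g i) :=
        Finset.sum_le_sum fun i _ => FF_le_iSup _ _ _
    _ = liminf (fun k : ℕ => ∑ i, FF (fun j => (dt q ((k : ℝ) + 1) j)⁻¹) (L i) V (g i)) atTop :=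
        h1.liminf_eq.symm
    _ ≤ _ := liminf_le_liminf (Eventually.of_forall hf)

variable [MeasurableSpace K] [BorelSpace K]

lemma gen_left {A B : Type*} [MeasurableSpace A] [MeasurableSpace B] (g : A → B → ℝ≥0∞)
    (hg : Measurable fun p : A × B => g p.1 p.2) (b : B) : Measurable fun a => g a b :=
  hg.comp (measurable_id.prodMk measurable_const)

lemma gen_swap {A B C : Type*} [MeasurableSpace A] [MeasurableSpace B] [MeasurableSpace C]
    (g : A → B → ℝ≥0∞) (hg : Measurable fun p : A × B => g p.1 p.2) (M : C → B)
    (hM : Measurable M) : Measurable fun p : C × A => g p.2 (M p.1) :=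
  hg.comp (measurable_snd.prodMk (hM.comp measurable_fst))

def EK (pinv : Matrix (Fin l) (Fin l) K → Matrix (Fin l) (Fin l) K) (hrn : r ≤ n) (d : Fin r → ℝ)
    (V : UG K r) (Ω : Matrix (Fin n) (Fin l) K) : ℝ≥0∞ :=
  errE pinv ((SM d (UM hrn V))ᴴ * SM d (UM hrn V)) Ω

lemma EK_measurable (pinv : Matrix (Fin l) (Fin l) K → Matrix (Fin l) (Fin l) K)
    (hpinv : ∀ A, IsMoorePenrose A (pinv A)) (hrn : r ≤ n) (d : Fin r → ℝ) :
    Measurable fun p : UG K r × Matrix (Fin n) (Fin l) K => EK pinv hrn d p.1 p.2 :=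
  errE_measurable pinv hpinv hrn d

lemma pointwise_lower (pinv : Matrix (Fin l) (Fin l) K → Matrix (Fin l) (Fin l) K)
    (hpinv : ∀ A, IsMoorePenrose A (pinv A)) (hrn : r ≤ n)
    (hq : (q : ℝ) + alphaK K < (l : ℝ)) (hlr : l < r) (Ω : Matrix (Fin n) (Fin l) K) :
    ((r - l : ℕ) : ℝ≥0∞) * ENNReal.ofReal (1 + (q : ℝ) / ((l : ℝ) - (q : ℝ) - alphaK K)) ≤
      liminf (fun k : ℕ => ∫⁻ V, EK pinv hrn (dt q ((k : ℝ) + 1)) V Ω ∂(hU K r)) atTop := by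
  obtain ⟨v, L, hv, hvL, hLr, h1, h2⟩ := exists_frame hrn Ω
  have hm : ∀ k : ℕ, Measurable fun V : UG K r => EK pinv hrn (dt q ((k : ℝ) + 1)) V Ω := fun k =>
    gen_left (EK pinv hrn (dt q ((k : ℝ) + 1))) (EK_measurable pinv hpinv hrn _) Ω
  refine le_trans ?_ (lintegral_liminf_le hm)
  have hd : ∀ (k : ℕ) (i : Fin r), 0 < dt q ((k : ℝ) + 1) i := by
    intro k i; unfold dt; split_ifs <;> positivity
  calc _ = ∑ i, ∫⁻ V, FF (ind q) (L i) V (v i) ∂(hU K r) := by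
        simp_rw [FF_final hq hlr (L _) (hLr _) (v _) (hvL _) (hv.1 _)]
        simp
    _ = ∫⁻ V, ∑ i, FF (ind q) (L i) V (v i) ∂(hU K r) :=
        (lintegral_finsetSum _ fun i _ => FF_measurable_left _ _ _).symm
    _ ≤ _ := by
        refine lintegral_mono fun V => ?_
        refine sum_FF_le_liminf L V v _ fun k => ?_
        rw [EK, errE_eq pinv hpinv]
        exact le_iInf fun X => err_lower hrn Ω v L hv hvL h1 h2 _ (hd k) V X

end final


/-- **Nyström approximation, sharp lower bound** (Theorem 3.6(b)): for any full-rank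
random embedding `Ω` and rank parameters `q + α_K < ℓ ≤ r ≤ n`, the worst case over
psd matrices `H` with `rank H = r` of `E tr(H − H⟨Ω⟩) / tr(H − [H]_q)` is at least
`((r − ℓ)/(r − q)) (1 + q/(ℓ − q − α_K))`. -/
theorem nystrom_lower_bound
    {K : Type*} [RCLike K] [MeasurableSpace K] [BorelSpace K]
    {Y : Type*} [MeasurableSpace Y] (μ : Measure Y) [IsProbabilityMeasure μ]
    (pinv : (m n : ℕ) → Matrix (Fin m) (Fin n) K → Matrix (Fin n) (Fin m) K)
    (hpinv : ∀ (m n : ℕ) (A : Matrix (Fin m) (Fin n) K), IsMoorePenrose A (pinv m n A))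
    (n ℓ q r : ℕ) (hℓn : ℓ ≤ n)
    (M : Y → Matrix (Fin n) (Fin ℓ) K)
    (hMmeas : Measurable M)
    (hMfull : ∀ᵐ ω ∂μ, (M ω).rank = ℓ)
    (hq : (q : ℝ) + alphaK K < (ℓ : ℝ)) (hℓr : ℓ ≤ r) (hrn : r ≤ n) :
    ENNReal.ofReal
        (((r : ℝ) - (ℓ : ℝ)) / ((r : ℝ) - (q : ℝ)) *
          (1 + (q : ℝ) / ((ℓ : ℝ) - (q : ℝ) - alphaK K))) ≤
      ⨆ (H : Matrix (Fin n) (Fin n) K) (Hq : Matrix (Fin n) (Fin n) K)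
        (_ : H.PosSemidef) (_ : H.rank = r) (_ : IsBestRankApprox q H Hq),
        (∫⁻ ω, ENNReal.ofReal (RCLike.re (Matrix.trace
            (H - H * M ω * (pinv ℓ ℓ ((M ω)ᴴ * H * M ω) * ((M ω)ᴴ * H))))) ∂μ) /
          ENNReal.ofReal (RCLike.re (Matrix.trace (H - Hq))) := by
  classical
  have hα : 0 ≤ alphaK K := by unfold alphaK; split_ifs <;> norm_num
  have hqℓ : q < ℓ := by
    have : (q : ℝ) < ℓ := by linarith
    exact_mod_cast this
  rcases Nat.eq_or_lt_of_le hℓr with rfl | hlt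
  · simp
  have hqr : q ≤ r := by omega
  have hrq : (0 : ℝ) < (r : ℝ) - q := by
    have : (q : ℝ) < r := by exact_mod_cast (by omega : q < r)
    linarith
  set S0 : ℝ≥0∞ := ⨆ (H : Matrix (Fin n) (Fin n) K) (Hq : Matrix (Fin n) (Fin n) K)
        (_ : H.PosSemidef) (_ : H.rank = r) (_ : IsBestRankApprox q H Hq),
        (∫⁻ ω, ENNReal.ofReal (RCLike.re (Matrix.trace
            (H - H * M ω * (pinv ℓ ℓ ((M ω)ᴴ * H * M ω) * ((M ω)ᴴ * H))))) ∂μ) /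
          ENNReal.ofReal (RCLike.re (Matrix.trace (H - Hq))) with hS0
  have key : ∀ (k : ℕ) (V : UG K r),
      ∫⁻ ω, EK (pinv ℓ ℓ) hrn (dt q ((k : ℝ) + 1)) V (M ω) ∂μ ≤
        S0 * ENNReal.ofReal ((r : ℝ) - q) := by
    intro k V
    have hd : ∀ i : Fin r, 0 < dt q ((k : ℝ) + 1) i := by
      intro i; unfold dt; split_ifs <;> positivity
    have hH : (SM (dt q ((k : ℝ) + 1)) (UM hrn V))ᴴ * SM (dt q ((k : ℝ) + 1)) (UM hrn V) =
        CD (UM hrn V) (dt q ((k : ℝ) + 1)) := HM_eq _ (fun i => (hd i).le) _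
    have hU := UM_gram hrn V
    have hpsd : (CD (UM hrn V) (dt q ((k : ℝ) + 1))).PosSemidef := by
      rw [← hH]; exact Matrix.posSemidef_conjTranspose_mul_self _
    have hbest := CD_best hqr (UM hrn V) hU ((k : ℝ) + 1) (by
      have : (0 : ℝ) ≤ k := by positivity
      linarith) (fun B => ⟨_, hpinv _ _ B⟩)
    have hrk := CD_rank (UM hrn V) hU (dt q ((k : ℝ) + 1)) hd
    have htr : RCLike.re (Matrix.trace (CD (UM hrn V) (dt q ((k : ℝ) + 1)) -
        CD (UM hrn V) (dq q ((k : ℝ) + 1)))) = (r : ℝ) - q := by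
      rw [CD_sub, trace_CD _ hU, sum_ind hqr]
    have h1 : (∫⁻ ω, EK (pinv ℓ ℓ) hrn (dt q ((k : ℝ) + 1)) V (M ω) ∂μ) /
        ENNReal.ofReal ((r : ℝ) - q) ≤ S0 := by
      rw [hS0, ← htr]
      simp only [EK, hH, errE]
      exact le_iSup_of_le _ (le_iSup_of_le _ (le_iSup_of_le hpsd (le_iSup_of_le hrk
        (le_iSup_of_le hbest le_rfl))))
    exact (ENNReal.div_le_iff (by simpa using hrq) ENNReal.ofReal_ne_top).1 h1
  have hm : ∀ k : ℕ, Measurable fun p : Y × UG K r =>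
      EK (pinv ℓ ℓ) hrn (dt q ((k : ℝ) + 1)) p.2 (M p.1) := fun k =>
    gen_swap (EK (pinv ℓ ℓ) hrn (dt q ((k : ℝ) + 1)))
      (EK_measurable (pinv ℓ ℓ) (hpinv ℓ ℓ) hrn _) M hMmeas
  have key2 : ∀ k : ℕ, ∫⁻ ω, ∫⁻ V, EK (pinv ℓ ℓ) hrn (dt q ((k : ℝ) + 1)) V (M ω) ∂(hU K r) ∂μ ≤
      S0 * ENNReal.ofReal ((r : ℝ) - q) := by
    intro k
    rw [lintegral_lintegral_swap
      (f := fun ω V => EK (pinv ℓ ℓ) hrn (dt q ((k : ℝ) + 1)) V (M ω)) (hm k).aemeasurable]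
    calc _ ≤ ∫⁻ _ : UG K r, S0 * ENNReal.ofReal ((r : ℝ) - q) ∂(hU K r) :=
          lintegral_mono fun V => key k V
      _ = _ := by simp
  have hmi : ∀ k : ℕ, Measurable fun ω : Y =>
      ∫⁻ V, EK (pinv ℓ ℓ) hrn (dt q ((k : ℝ) + 1)) V (M ω) ∂(hU K r) := fun k =>
    (hm k).lintegral_prod_right'
  have hfin : ((r - ℓ : ℕ) : ℝ≥0∞) *
      ENNReal.ofReal (1 + (q : ℝ) / ((ℓ : ℝ) - (q : ℝ) - alphaK K)) ≤
      S0 * ENNReal.ofReal ((r : ℝ) - q) := by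
    calc _ = ∫⁻ _ : Y, ((r - ℓ : ℕ) : ℝ≥0∞) *
          ENNReal.ofReal (1 + (q : ℝ) / ((ℓ : ℝ) - (q : ℝ) - alphaK K)) ∂μ := by simp
      _ ≤ ∫⁻ ω, liminf (fun k : ℕ =>
            ∫⁻ V, EK (pinv ℓ ℓ) hrn (dt q ((k : ℝ) + 1)) V (M ω) ∂(hU K r)) atTop ∂μ :=
          lintegral_mono fun ω => pointwise_lower (pinv ℓ ℓ) (hpinv ℓ ℓ) hrn hq hlt (M ω)
      _ ≤ liminf (fun k : ℕ => ∫⁻ ω,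
            ∫⁻ V, EK (pinv ℓ ℓ) hrn (dt q ((k : ℝ) + 1)) V (M ω) ∂(hU K r) ∂μ) atTop :=
          lintegral_liminf_le hmi
      _ ≤ liminf (fun _ : ℕ => S0 * ENNReal.ofReal ((r : ℝ) - q)) atTop :=
          liminf_le_liminf (Eventually.of_forall key2)
      _ = _ := by simp
  have hrl : (0 : ℝ) ≤ (r : ℝ) - ℓ := by
    have : (ℓ : ℝ) ≤ r := by exact_mod_cast hℓr
    linarith
  have hcast : ((r - ℓ : ℕ) : ℝ≥0∞) = ENNReal.ofReal ((r : ℝ) - ℓ) := by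
    rw [← ENNReal.ofReal_natCast, Nat.cast_sub hℓr]
  rw [hcast, ← ENNReal.ofReal_mul hrl] at hfin
  rw [div_mul_eq_mul_div, ENNReal.ofReal_div_of_pos hrq]
  exact ENNReal.div_le_of_le_mul hfin
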